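/- Fix n_0 ≥ 1 and a Boolean function f of n_0 variables whose tree size complexity satisfies L(f) ≥ 3, identified for n ≥ n_0 with its extension to n variables. Then P_n(f) = Θ(n^{−L(f)}) as n → ∞: there exist constants 0 < c₁ ≤ c₂ and an integer N such that c₁·n^{−L(f)} ≤ P_n(f) ≤ c₂·n^{−L(f)} for all n ≥ N. -/

import Mathlib

/-- An and/or tree skeleton: leaves carry a variable index and a polarity
(`true` = positive literal, `false` = negated literal); internal nodes carry
a connective (`true` = AND, `false` = OR) and a list of children. -/
inductive AT (n : ℕ) : Type
  | leaf : Fin n → Bool → AT n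
  | node : Bool → List (AT n) → AT n

namespace AT

/-- The connective at the root, if the root is an internal node. -/
def rootConn {n : ℕ} : AT n → Option Bool
  | .leaf _ _ => none
  | .node c _ => some c

/-- Whether a tree is a single leaf. -/
def isLeafB {n : ℕ} : AT n → Bool
  | .leaf _ _ => true
  | .node _ _ => false

/-- The children of the root. -/
def rootChildren {n : ℕ} : AT n → List (AT n)
  | .leaf _ _ => []
  | .node _ ts => ts

/-- Well-formedness: an associative tree is a plane tree in which each internal
node has at least two children, no internal node has the same connective as its
parent (stratification), and leaves carry literals. -/
inductive WF {n : ℕ} : AT n → Prop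
  | leaf (i : Fin n) (b : Bool) : WF (.leaf i b)
  | node (c : Bool) (ts : List (AT n)) :
      2 ≤ ts.length → (∀ t ∈ ts, WF t) → (∀ t ∈ ts, rootConn t ≠ some c) →
      WF (.node c ts)

mutual
/-- The size of a tree: its total number of nodes. -/
def size {n : ℕ} : AT n → ℕ
  | .leaf _ _ => 1
  | .node _ ts => 1 + sizeList ts
def sizeList {n : ℕ} : List (AT n) → ℕ
  | [] => 0
  | t :: ts => size t + sizeList ts
end

mutual
/-- The Boolean function computed by a tree. -/
def eval {n : ℕ} : AT n → (Fin n → Bool) → Bool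
  | .leaf i b, x => if b then x i else ! x i
  | .node c ts, x => evalList c ts x
def evalList {n : ℕ} : Bool → List (AT n) → (Fin n → Bool) → Bool
  | c, [], _ => c
  | c, t :: ts, x => if c then eval t x && evalList c ts x
                     else eval t x || evalList c ts x
end

end AT

open AT

/-- Number of associative trees of size `m` in a family `𝒯`. -/
noncomputable def countIn (n : ℕ) (𝒯 : Set (AT n)) (m : ℕ) : ℕ :=
  Nat.card {t : AT n // t ∈ 𝒯 ∧ WF t ∧ size t = m}

/-- `A n m` is the number of associative trees of size `m` on `n` variables. -/
noncomputable def A (n m : ℕ) : ℕ := countIn n Set.univ m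

/-- `Pmn n m f` is the proportion, among associative trees of size `m` on `n`
variables, of those computing the Boolean function `f`. -/
noncomputable def Pmn (n m : ℕ) (f : (Fin n → Bool) → Bool) : ℝ :=
  (countIn n {t | eval t = f} m : ℝ) / (A n m : ℝ)

/-- Ratio of trees of size `m` in the family `𝒯` among all trees of size `m`. -/
noncomputable def ratio (n : ℕ) (𝒯 : Set (AT n)) (m : ℕ) : ℝ :=
  (countIn n 𝒯 m : ℝ) / (A n m : ℝ)

/-- `HasLimRatio n 𝒯 μ` : the limiting ratio of the family `𝒯` exists and is `μ`. -/
def HasLimRatio (n : ℕ) (𝒯 : Set (AT n)) (μ : ℝ) : Prop :=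
  Filter.Tendsto (ratio n 𝒯) Filter.atTop (nhds μ)

/-- Extension of a Boolean function of `n₀` variables to `n ≥ n₀` variables. -/
def extend {n₀ n : ℕ} (h : n₀ ≤ n) (f : (Fin n₀ → Bool) → Bool) :
    (Fin n → Bool) → Bool :=
  fun x => f (fun j => x (Fin.castLE h j))

open Classical in
/-- The tree size complexity of a Boolean function. -/
noncomputable def Lcomp (n : ℕ) (f : (Fin n → Bool) → Bool) : ℕ :=
  if f = (fun _ => true) ∨ f = (fun _ => false) then 0
  else if ∃ i : Fin n, f = (fun x => x i) ∨ f = (fun x => ! x i) then 2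
  else sInf {m | ∃ t : AT n, WF t ∧ size t = m ∧ eval t = f}

namespace TreeAux

open Finset

/-! ### Generic counting -/

section generic

/-- number of `a` satisfying `P` with size `m` and value `d` -/
noncomputable def cnt {α D : Type*} (P : α → Prop) (s : α → ℕ) (v : α → D) (m : ℕ) (d : D) : ℕ :=
  Set.ncard {a | P a ∧ s a = m ∧ v a = d}

def FinP {α : Type*} (P : α → Prop) (s : α → ℕ) : Prop := ∀ m, {a | P a ∧ s a = m}.Finite

theorem FinP.fin {α D : Type*} {P : α → Prop} {s : α → ℕ} (h : FinP P s) (v : α → D) (m : ℕ) (d : D) :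
    {a | P a ∧ s a = m ∧ v a = d}.Finite :=
  (h m).subset (fun _ ha => ⟨ha.1, ha.2.1⟩)

theorem cnt_prod {α β D : Type*} [Fintype D] [DecidableEq D] {P : α → Prop} {s : α → ℕ} (v : α → D) {P' : β → Prop} {s' : β → ℕ}
    (v' : β → D) (h : FinP P s) (h' : FinP P' s') (o : D → D → D) (m : ℕ) (d : D) :
    cnt (fun a : α × β => P a.1 ∧ P' a.2) (fun a => s a.1 + s' a.2)
      (fun a => o (v a.1) (v' a.2)) m d =
    ∑ p ∈ antidiagonal m, ∑ g : D, ∑ h : D,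
      if o g h = d then cnt P s v p.1 g * cnt P' s' v' p.2 h else 0 := by
  classical
  have e : ∀ p ∈ antidiagonal m, (∑ g : D, ∑ h : D,
      if o g h = d then cnt P s v p.1 g * cnt P' s' v' p.2 h else 0) =
      ∑ q ∈ (Finset.univ : Finset (D × D)).filter (fun q => o q.1 q.2 = d),
        cnt P s v p.1 q.1 * cnt P' s' v' p.2 q.2 := by
    intro p _
    rw [Finset.sum_filter, ← Finset.univ_product_univ, Finset.sum_product]
  rw [Finset.sum_congr rfl e, ← Finset.sum_product']
  have e2 : ∀ x : (ℕ × ℕ) × (D × D), cnt P s v x.1.1 x.2.1 * cnt P' s' v' x.1.2 x.2.2 =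
      ((h.fin v x.1.1 x.2.1).toFinset ×ˢ (h'.fin v' x.1.2 x.2.2).toFinset).card := by
    intro x
    rw [Finset.card_product, cnt, cnt, Set.ncard_eq_toFinset_card _ (h.fin v _ _),
      Set.ncard_eq_toFinset_card _ (h'.fin v' _ _)]
  rw [Finset.sum_congr rfl (fun x _ => e2 x), ← Finset.card_sigma, cnt,
    ← Set.ncard_coe_finset]
  symm
  refine Set.ncard_congr (fun x _ => x.2) ?_ ?_ ?_
  · rintro ⟨⟨⟨a, b⟩, g, h⟩, x, y⟩ hx
    simp at hx ⊢
    grind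
  · rintro ⟨⟨⟨a, b⟩, g, h⟩, x, y⟩ ⟨⟨⟨a', b'⟩, g', h'⟩, x', y'⟩ hx hy hxy
    simp at hx hy hxy ⊢
    grind
  · rintro ⟨x, y⟩ hx
    simp at hx
    refine ⟨⟨⟨⟨s x, s' y⟩, v x, v' y⟩, x, y⟩, ?_, rfl⟩
    simp
    grind

theorem sum_cnt {α D : Type*} [Fintype D] {P : α → Prop} {s : α → ℕ} (v : α → D) (h : FinP P s) (m : ℕ) :
    ∑ d : D, cnt P s v m d = Set.ncard {a | P a ∧ s a = m} := by
  classical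
  rw [Set.ncard_eq_toFinset_card _ (h m)]
  rw [Finset.card_eq_sum_card_fiberwise (f := v) (t := Finset.univ) (by simp)]
  refine Finset.sum_congr rfl (fun d _ => ?_)
  rw [cnt, ← Set.ncard_coe_finset]
  congr 1
  ext a
  simp [and_assoc]

end generic
end TreeAux

namespace TreeAux
open Finset AT

/-! ### Trees: values, finiteness -/

variable {X : Type*} {n : ℕ}

/-- pointwise connective -/
def op (c : Bool) (g h : X → Bool) : X → Bool := fun x => if c then g x && h x else g x || h x

/-- unit of the connective -/
def un (c : Bool) : X → Bool := fun _ => c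

theorem op_assoc (c : Bool) (f g h : X → Bool) : op c (op c f g) h = op c f (op c g h) := by
  funext x; cases c <;> simp [op, Bool.and_assoc, Bool.or_assoc]

theorem op_comm (c : Bool) (f g : X → Bool) : op c f g = op c g f := by
  funext x; cases c <;> simp [op, Bool.and_comm, Bool.or_comm]

@[simp] theorem op_un (c : Bool) (f : X → Bool) : op c f (un c) = f := by
  funext x; cases c <;> simp [op, un]
@[simp] theorem un_op (c : Bool) (f : X → Bool) : op c (un c) f = f := by
  funext x; cases c <;> simp [op, un]
@[simp] theorem op_abs (c : Bool) (f : X → Bool) : op c f (un (!c)) = un (!c) := by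
  funext x; cases c <;> simp [op, un]
@[simp] theorem abs_op (c : Bool) (f : X → Bool) : op c (un (!c)) f = un (!c) := by
  funext x; cases c <;> simp [op, un]

theorem op_eq_un {c : Bool} {f g : X → Bool} (h : op c f g = un c) : f = un c ∧ g = un c := by
  constructor <;> funext x <;> have := congrFun h x <;> cases c <;> simp [op, un] at this ⊢ <;>
    simp [this]

def val (ι : X → Fin n → Bool) (t : AT n) : X → Bool := fun x => eval t (ι x)
def valL (ι : X → Fin n → Bool) (c : Bool) (l : List (AT n)) : X → Bool :=
  fun x => evalList c l (ι x)

@[simp] theorem valL_nil (ι : X → Fin n → Bool) (c : Bool) : valL ι c [] = un c := by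
  funext x; simp [valL, evalList, un]
@[simp] theorem valL_cons (ι : X → Fin n → Bool) (c : Bool) (t : AT n) (l : List (AT n)) :
    valL ι c (t :: l) = op c (val ι t) (valL ι c l) := by
  funext x; simp [valL, evalList, op, val]
theorem valL_append (ι : X → Fin n → Bool) (c : Bool) (l l' : List (AT n)) :
    valL ι c (l ++ l') = op c (valL ι c l) (valL ι c l') := by
  induction l with
  | nil => simp
  | cons t l ih => simp [ih, op_assoc]
@[simp] theorem val_node (ι : X → Fin n → Bool) (c : Bool) (l : List (AT n)) :
    val ι (.node c l) = valL ι c l := by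
  funext x; simp [valL, eval, val]

@[simp] theorem sizeList_nil : sizeList ([] : List (AT n)) = 0 := by simp [sizeList]
@[simp] theorem sizeList_cons (t : AT n) (l : List (AT n)) :
    sizeList (t :: l) = size t + sizeList l := by simp [sizeList]
theorem sizeList_append (l l' : List (AT n)) : sizeList (l ++ l') = sizeList l + sizeList l' := by
  induction l with
  | nil => simp
  | cons t l ih => simp [ih, add_assoc]
@[simp] theorem size_node (c : Bool) (l : List (AT n)) : size (.node c l) = 1 + sizeList l := by
  simp [size]
@[simp] theorem size_leaf (i : Fin n) (b : Bool) : size (.leaf i b) = 1 := by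
  simp [size]
theorem size_pos (t : AT n) : 1 ≤ size t := by cases t <;> simp
theorem size_le_of_mem {t : AT n} {l : List (AT n)} (h : t ∈ l) : size t ≤ sizeList l := by
  induction l with
  | nil => simp at h
  | cons a l ih =>
    rcases List.mem_cons.1 h with rfl | h
    · simp
    · have := ih h
      simp; omega

/-- admissible children of a `c`-node -/
def Adm (c : Bool) (t : AT n) : Prop := WF t ∧ rootConn t ≠ some c
def AdmL (c : Bool) (l : List (AT n)) : Prop := ∀ t ∈ l, Adm c t
/-- well-formed trees with root `c` -/
def Rtd (c : Bool) (t : AT n) : Prop := WF t ∧ rootConn t = some c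

theorem Rtd_iff {c : Bool} {t : AT n} :
    Rtd c t ↔ ∃ l, t = .node c l ∧ 2 ≤ l.length ∧ AdmL c l := by
  constructor
  · rintro ⟨h, h2⟩
    cases h with
    | leaf i b => simp [rootConn] at h2
    | node c' l h3 h4 h5 =>
      simp [rootConn] at h2
      subst h2
      exact ⟨l, rfl, h3, fun t ht => ⟨h4 t ht, h5 t ht⟩⟩
  · rintro ⟨l, rfl, h, h'⟩
    exact ⟨WF.node c l h (fun t ht => (h' t ht).1) (fun t ht => (h' t ht).2), rfl⟩

theorem Adm_not_iff {c : Bool} {t : AT n} :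
    Adm (!c) t ↔ (∃ i b, t = .leaf i b) ∨ Rtd c t := by
  cases t with
  | leaf i b => simp [Adm, Rtd, rootConn, WF.leaf]
  | node c' l => cases c <;> cases c' <;> simp [Adm, Rtd, rootConn]

theorem finite_le (m : ℕ) : {t : AT n | size t ≤ m}.Finite ∧ {l : List (AT n) | sizeList l ≤ m}.Finite := by
  induction m with
  | zero =>
    constructor
    · convert Set.finite_empty
      ext t; have := size_pos t; simp; omega
    · refine (Set.finite_singleton ([] : List (AT n))).subset ?_
      rintro (_ | ⟨t, l⟩) h
      · rfl
      · have := size_pos t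
        simp at h; omega
  | succ m ih =>
    have h1 : {t : AT n | size t ≤ m + 1}.Finite := by
      refine ((Set.finite_range (fun p : Fin n × Bool => AT.leaf p.1 p.2)).union
        (Set.Finite.image2 AT.node (Set.finite_univ) ih.2)).subset ?_
      rintro (⟨i, b⟩ | ⟨c, l⟩) h
      · left; exact ⟨(i, b), rfl⟩
      · right
        exact ⟨c, trivial, l, by simp at h ⊢; omega, rfl⟩
    refine ⟨h1, ?_⟩
    refine ((Set.finite_singleton ([] : List (AT n))).union
      (Set.Finite.image2 List.cons h1 ih.2)).subset ?_
    rintro (_ | ⟨t, l⟩) h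
    · left; rfl
    · right
      have := size_pos t
      simp at h
      exact ⟨t, by simp; omega, l, by simp; omega, rfl⟩

theorem finP_tree (P : AT n → Prop) : FinP P size := fun m =>
  (finite_le m).1.subset (fun _ h => h.2.le)
theorem finP_list (P : List (AT n) → Prop) : FinP P sizeList := fun m =>
  (finite_le m).2.subset (fun _ h => h.2.le)
theorem finP_pair (P : List (AT n) × List (AT n) → Prop) :
    FinP P (fun a => sizeList a.1 + sizeList a.2) := fun m =>
  ((finite_le m).2.prod (finite_le m).2).subset (by
    rintro ⟨a, b⟩ h
    simp at h ⊢
    omega)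

/-! ### Counting sequences -/

variable (ι : X → Fin n → Bool)

noncomputable def tN (c : Bool) (m : ℕ) (d : X → Bool) : ℕ := cnt (Adm c) size (val ι) m d
noncomputable def lN (c : Bool) (m : ℕ) (d : X → Bool) : ℕ := cnt (AdmL c) sizeList (valL ι c) m d
noncomputable def rN (c : Bool) (m : ℕ) (d : X → Bool) : ℕ := cnt (Rtd c) size (val ι) m d
noncomputable def qN (c : Bool) (m : ℕ) (d : X → Bool) : ℕ :=
  cnt (fun a : List (AT n) × List (AT n) => AdmL c a.1 ∧ AdmL c a.2)
    (fun a => sizeList a.1 + sizeList a.2) (fun a => op c (valL ι c a.1) (valL ι c a.2)) m d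
open Classical in
noncomputable def leafN (d : X → Bool) : ℕ :=
  (univ.filter (fun p : Fin n × Bool => val ι (.leaf p.1 p.2) = d)).card

theorem lN_zero [DecidableEq X] [Fintype X] (c : Bool) (d : X → Bool) :
    lN ι c 0 d = if d = un c then 1 else 0 := by
  have : {l : List (AT n) | AdmL c l ∧ sizeList l = 0 ∧ valL ι c l = d} =
      if d = un c then {[]} else ∅ := by
    ext l
    cases l with
    | nil => split_ifs with h <;> simp [AdmL, h, eq_comm]
    | cons t l => have := size_pos t; split_ifs <;> simp <;> omega
  rw [lN, cnt, this]
  split_ifs <;> simp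

theorem tN_zero (c : Bool) (d : X → Bool) : tN ι c 0 d = 0 := by
  have : {t : AT n | Adm c t ∧ size t = 0 ∧ val ι t = d} = ∅ := by
    ext t; have := size_pos t; simp; omega
  rw [tN, cnt, this]; simp

theorem qN_eq [DecidableEq X] [Fintype X] (c : Bool) (m : ℕ) (d : X → Bool) :
    qN ι c m d = ∑ p ∈ antidiagonal m, ∑ g : X → Bool, ∑ h : X → Bool,
      if op c g h = d then lN ι c p.1 g * lN ι c p.2 h else 0 := by
  rw [qN]
  exact cnt_prod (valL ι c) (valL ι c) (finP_list _) (finP_list _) (op c) m d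

theorem lN_eq [DecidableEq X] [Fintype X] (c : Bool) (m : ℕ) (d : X → Bool) :
    lN ι c m d = (if m = 0 ∧ d = un c then 1 else 0) +
     ∑ p ∈ antidiagonal m, ∑ g : X → Bool, ∑ h : X → Bool,
      if op c g h = d then tN ι c p.1 g * lN ι c p.2 h else 0 := by
  rcases Nat.eq_zero_or_pos m with rfl | hm
  · rw [lN_zero]; simp [tN_zero]
  rw [if_neg (by omega), zero_add]
  simp only [tN, lN]
  rw [← cnt_prod (val ι) (valL ι c) (finP_tree _) (finP_list _) (op c) m d, cnt, cnt]
  symm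
  refine Set.ncard_congr (fun a _ => a.1 :: a.2) ?_ ?_ ?_
  · rintro ⟨t, l⟩ ⟨⟨h1, h2⟩, h3, h4⟩
    simp at h1 h2 h3 h4
    refine ⟨?_, by simpa using h3, by simpa using h4⟩
    intro s hs
    rcases List.mem_cons.1 hs with rfl | hs
    exacts [h1, h2 _ hs]
  · rintro ⟨t, l⟩ ⟨t', l'⟩ _ _ h
    simpa using h
  · rintro (_ | ⟨t, l⟩) ⟨h1, h2, h3⟩
    · simp at h2; omega
    · exact ⟨(t, l), ⟨⟨h1 t (by simp), fun s hs => h1 s (by simp [hs])⟩, by simpa using h2,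
        by simpa using h3⟩, rfl⟩

theorem rN_eq [DecidableEq X] [Fintype X] (c : Bool) (m : ℕ) (d : X → Bool) :
    lN ι c m d = (if m = 0 ∧ d = un c then 1 else 0) + tN ι c m d + rN ι c (m + 1) d := by
  have h1 : {l : List (AT n) | AdmL c l ∧ sizeList l = m ∧ valL ι c l = d} =
     ((if m = 0 ∧ d = un c then {[]} else ∅) ∪
       (fun t => [t]) '' {t : AT n | Adm c t ∧ size t = m ∧ val ι t = d}) ∪
       {l : List (AT n) | 2 ≤ l.length ∧ AdmL c l ∧ sizeList l = m ∧ valL ι c l = d} := by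
    ext l
    rcases l with _ | ⟨t, _ | ⟨t', l⟩⟩
    · split_ifs with h
      · simp [AdmL, h]
      · simp [AdmL]
        rintro rfl rfl
        simp at h
    · split_ifs with h <;> simp [AdmL]
    · split_ifs with h <;> simp
  have h2 : {t : AT n | Rtd c t ∧ size t = m + 1 ∧ val ι t = d} =
     (fun l => AT.node c l) '' {l : List (AT n) | 2 ≤ l.length ∧ AdmL c l ∧ sizeList l = m ∧ valL ι c l = d} := by
    ext t
    simp only [Set.mem_image, Set.mem_ofPred_eq, Rtd_iff]
    constructor
    · rintro ⟨⟨l, rfl, h1, h2⟩, h3, h4⟩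
      exact ⟨l, ⟨h1, h2, by simp at h3; omega, by simpa using h4⟩, rfl⟩
    · rintro ⟨l, ⟨h1, h2, h3, h4⟩, rfl⟩
      exact ⟨⟨l, rfl, h1, h2⟩, by simp [h3]; omega, by simpa using h4⟩
  have f1 : {l : List (AT n) | 2 ≤ l.length ∧ AdmL c l ∧ sizeList l = m ∧ valL ι c l = d}.Finite :=
    (finite_le m).2.subset (fun l h => h.2.2.1.le)
  have f2 := (finP_tree (Adm (n := n) c)).fin (val ι) m d
  have f0 : (if m = 0 ∧ d = un c then {[]} else ∅ : Set (List (AT n))).Finite := by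
    split_ifs <;> simp
  rw [lN, cnt, h1, Set.ncard_union_eq ?_ (f0.union (f2.image _)) f1, Set.ncard_union_eq ?_ f0 (f2.image _),
    Set.ncard_image_of_injective _ (fun a b h => by simpa using h), rN, cnt, h2,
    Set.ncard_image_of_injective _ (fun a b h => by simpa using h)]
  · congr 2
    split_ifs <;> simp
  · rw [Set.disjoint_left]
    intro l hl
    split_ifs at hl <;> simp at hl ⊢
    subst hl; simp
  · rw [Set.disjoint_left]
    rintro l (hl | ⟨t, _, rfl⟩)
    · split_ifs at hl <;> simp at hl ⊢
      subst hl; simp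
    · simp

theorem tN_eq (c : Bool) (m : ℕ) (d : X → Bool) :
    tN ι (!c) m d = (if m = 1 then leafN ι d else 0) + rN ι c m d := by
  classical
  have h1 : {t : AT n | Adm (!c) t ∧ size t = m ∧ val ι t = d} =
     (if m = 1 then (fun p : Fin n × Bool => AT.leaf p.1 p.2) ''
       (univ.filter (fun p : Fin n × Bool => val ι (.leaf p.1 p.2) = d)) else ∅) ∪
       {t : AT n | Rtd c t ∧ size t = m ∧ val ι t = d} := by
    ext t
    simp only [Adm_not_iff, Set.mem_union, Set.mem_ofPred_eq]
    constructor
    · rintro ⟨⟨i, b, rfl⟩ | h, h2, h3⟩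
      · left
        simp at h2
        rw [if_pos h2.symm]
        exact ⟨(i, b), by simpa using h3, rfl⟩
      · exact Or.inr ⟨h, h2, h3⟩
    · rintro (h | h)
      · split_ifs at h with hm
        · obtain ⟨p, h1, rfl⟩ := h
          exact ⟨Or.inl ⟨_, _, rfl⟩, by simp [hm], by simpa using h1⟩
        · simp at h
      · exact ⟨Or.inr h.1, h.2⟩
  rw [tN, cnt, h1, Set.ncard_union_eq ?_ ?_ ?_, rN, cnt, leafN]
  · congr 1
    split_ifs
    · rw [Set.ncard_image_of_injective, Set.ncard_coe_finset]
      rintro ⟨a, b⟩ ⟨a', b'⟩ h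
      simpa using h
    · simp
  · rw [Set.disjoint_left]
    intro t ht h
    split_ifs at ht
    · obtain ⟨p, h1, rfl⟩ := ht
      simpa [Rtd, rootConn] using h.1
    · simp at ht
  · split_ifs
    · exact (Finset.finite_toSet _).image _
    · simp
  · exact (finP_tree _).fin (val ι) m d

theorem rN_lower [DecidableEq X] [Fintype X] (c : Bool) (m K : ℕ) (hm : 2 * K < m) (d : X → Bool) :
    ∑ p ∈ antidiagonal m, ∑ g : X → Bool, ∑ h : X → Bool,
      (if op c g h = d then (if 1 ≤ p.1 ∧ p.1 ≤ K then qN ι c p.1 g else 0) * tN ι c p.2 h else 0)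
      ≤ rN ι c (m + 1) d := by
  have e : ∀ k g, (if 1 ≤ k ∧ k ≤ K then qN ι c k g else 0) =
      cnt (fun a : List (AT n) × List (AT n) => (AdmL c a.1 ∧ AdmL c a.2) ∧
         1 ≤ sizeList a.1 + sizeList a.2 ∧ sizeList a.1 + sizeList a.2 ≤ K)
    (fun a => sizeList a.1 + sizeList a.2) (fun a => op c (valL ι c a.1) (valL ι c a.2)) k g := by
    intro k g
    rw [qN, cnt, cnt]
    split_ifs with h
    · congr 1
      ext a
      simp
      grind
    · symm
      rw [Set.ncard_eq_zero ((finP_pair _).fin _ _ _)]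
      ext a
      simp
      grind
  simp only [e, tN]
  rw [← cnt_prod _ (val ι) (finP_pair _) (finP_tree _) (op c) m d, cnt, rN, cnt]
  refine Set.ncard_le_ncard_of_injOn (fun a => AT.node c (a.1.1 ++ a.2 :: a.1.2)) ?_ ?_
    ((finP_tree _).fin (val ι) _ d)
  · rintro ⟨⟨u, v⟩, t⟩ ⟨⟨⟨⟨h1, h2⟩, h3⟩, h4⟩, h5, h6⟩
    simp only at h1 h2 h3 h4 h5 h6
    refine ⟨Rtd_iff.2 ⟨_, rfl, ?_, ?_⟩, ?_, ?_⟩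
    · rcases u with _ | ⟨_, u⟩ <;> rcases v with _ | ⟨_, v⟩ <;> simp at h3 ⊢
      omega
    · intro s hs
      simp at hs
      rcases hs with hs | rfl | hs
      exacts [h1 _ hs, h4, h2 _ hs]
    · simp [sizeList_append]; omega
    · rw [val_node, valL_append, valL_cons, ← h6, op_assoc, op_comm c (val ι t)]
  · rintro ⟨⟨u, v⟩, t⟩ ⟨⟨⟨⟨h1, h2⟩, h3⟩, h4⟩, h5, h6⟩ ⟨⟨u', v'⟩, t'⟩ ⟨⟨⟨⟨h1', h2'⟩, h3'⟩, h4'⟩, h5', h6'⟩ h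
    simp only [AT.node.injEq, true_and] at h h1 h2 h3 h4 h5 h6 h1' h2' h3' h4' h5' h6'
    rcases List.append_eq_append_iff.1 h with ⟨a, ha, hb⟩ | ⟨a, ha, hb⟩
    · rcases a with _ | ⟨s, a⟩
      · simp at ha hb; simp [ha, hb]
      · simp at hb
        obtain ⟨rfl, hb⟩ := hb
        have : size t ≤ sizeList u' := size_le_of_mem (by simp [ha])
        omega
    · rcases a with _ | ⟨s, a⟩
      · simp at ha hb; simp [ha, hb]
      · simp at hb
        obtain ⟨rfl, hb⟩ := hb
        have : size t' ≤ sizeList u := size_le_of_mem (by simp [ha])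
        omega

end TreeAux

namespace TreeAux
open Finset Filter Topology

/-! ### The scalar sequence: ratio limit -/

theorem tendsto_zero_of_contract {x ε : ℕ → ℝ} {q : ℝ} (hq0 : 0 ≤ q) (hq : q < 1)
    (hx : ∀ m, 0 ≤ x m) (h : ∀ᶠ m in atTop, x (m + 1) ≤ ε m + q * x m)
    (hε : Tendsto ε atTop (𝓝 0)) : Tendsto x atTop (𝓝 0) := by
  obtain ⟨M0, hM0⟩ := eventually_atTop.1 h
  rw [Metric.tendsto_atTop]
  intro e he
  have he' : 0 < e * (1 - q) / 2 := by have : 0 < 1 - q := by linarith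
                                       positivity
  obtain ⟨M1, hM1⟩ := eventually_atTop.1 (hε.eventually (gt_mem_nhds he'))
  set M := max M0 M1
  have key : ∀ k, x (M + k) ≤ e / 2 + q ^ k * x M := by
    intro k
    induction k with
    | zero => simp; linarith
    | succ k ih =>
      have h1 := hM0 (M + k) (by omega)
      have h2 := hM1 (M + k) (by omega)
      have h3 : q * x (M + k) ≤ q * (e / 2 + q ^ k * x M) := by gcongr
      rw [pow_succ]
      rw [← add_assoc]
      nlinarith
  have h4 : Tendsto (fun k => q ^ k * x M) atTop (𝓝 (0 * x M)) :=
    (tendsto_pow_atTop_nhds_zero_of_lt_one hq0 hq).mul_const _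
  rw [zero_mul] at h4
  obtain ⟨k0, hk0⟩ := eventually_atTop.1 (h4.eventually (gt_mem_nhds (half_pos he)))
  refine ⟨M + k0, fun m hm => ?_⟩
  obtain ⟨k, rfl⟩ := Nat.exists_eq_add_of_le (show M ≤ m by omega)
  have h5 := key k
  have h6 := hk0 k (by omega)
  rw [Real.dist_eq, sub_zero, abs_of_nonneg (hx _)]
  linarith

theorem eventually_atTop_of_shift {P : ℕ → Prop} {k : ℕ} (h : ∀ᶠ m in atTop, P (m + k)) :
    ∀ᶠ m in atTop, P m := by
  obtain ⟨M, hM⟩ := eventually_atTop.1 h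
  refine eventually_atTop.2 ⟨M + k, fun m hm => ?_⟩
  have := hM (m - k) (by omega)
  rwa [Nat.sub_add_cancel (by omega)] at this

/-- The square-root recurrence. -/
theorem w_rec {N : ℝ} {b l : ℕ → ℝ} (hl : ∀ m, l m = (if m = 0 then 1 else 0) +
      ∑ p ∈ antidiagonal m, b p.1 * l p.2)
    (hb0 : b 0 = 0)
    (hb : ∀ m, b (m + 1) = (if m = 0 then 2 * N else 0) + (l m - (if m = 0 then 1 else 0) - b m))
    (w : ℕ → ℝ) (hw : ∀ m, w m = 2 * (b (m + 2) + b (m + 1))) (m : ℕ) :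
    ((m : ℝ) + 4) * w (m + 2) = 2 * N * (2 * m + 5) * w (m + 1)
      - 4 * N * (N - 2) * (m + 1) * w m := by
  open PowerSeries in
  let B : PowerSeries ℝ := PowerSeries.mk b
  let Lp : PowerSeries ℝ := PowerSeries.mk l
  have e1 : Lp = 1 + B * Lp := by
    ext k
    simp [Lp, B, PowerSeries.coeff_mul, PowerSeries.coeff_one, ← hl]
  have e2 : B = C (2 * N) * X + X * (Lp - 1 - B) := by
    ext k
    cases k with
    | zero => simp [B, hb0]
    | succ k =>
      simp only [B, Lp, PowerSeries.coeff_mk, hb k, map_add, map_sub, PowerSeries.coeff_succ_X_mul,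
        PowerSeries.coeff_C_mul, PowerSeries.coeff_one, PowerSeries.coeff_X]
      simp
  set Y : PowerSeries ℝ := 1 + C (2 * N) * X - 2 * (1 + X) * B with hY
  have e3 : B - B ^ 2 - C (2 * N) * X * (1 - B) - X * B ^ 2 = 0 := by
    linear_combination (1 - B) * e2 + X * e1
  have e4 : Y ^ 2 = 1 - C (4 * N) * X + C (4 * N * (N - 2)) * X ^ 2 := by
    have c1 : (C (4 * N) : PowerSeries ℝ) = 2 * C (2 * N) := by
      rw [two_mul, ← map_add]; congr 1; ring
    have c2 : (C (4 * N * (N - 2)) : PowerSeries ℝ) = C (2 * N) ^ 2 - 4 * C (2 * N) := by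
      rw [show (4 : PowerSeries ℝ) = C 4 from (map_ofNat C 4).symm, ← map_pow, ← map_mul, ← map_sub]
      congr 1; ring
    rw [c1, c2, hY]
    linear_combination (-4 * (1 + X)) * e3
  have e5 : 2 * Y * d⁄dX ℝ Y = - C (4 * N) + 2 * C (4 * N * (N - 2)) * X := by
    have := congrArg (d⁄dX ℝ) e4
    simp only [Derivation.leibniz_pow, map_add, map_sub, Derivation.leibniz, PowerSeries.derivative_C,
      PowerSeries.derivative_X, smul_eq_mul, Derivation.map_one_eq_zero, nsmul_eq_mul] at this
    simp only [Nat.cast_ofNat] at this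
    linear_combination this
  have e6 : 2 * (1 - C (4 * N) * X + C (4 * N * (N - 2)) * X ^ 2) * d⁄dX ℝ Y =
      (- C (4 * N) + 2 * C (4 * N * (N - 2)) * X) * Y := by
    rw [← e4]; linear_combination Y * e5
  have e7 : d⁄dX ℝ Y - C (4 * N) * (X * d⁄dX ℝ Y) + C (4 * N * (N - 2)) * (X * (X * d⁄dX ℝ Y)) =
      - C (2 * N) * Y + C (4 * N * (N - 2)) * (X * Y) := by
    have c1 : (C (4 * N) : PowerSeries ℝ) = 2 * C (2 * N) := by
      rw [two_mul, ← map_add]; congr 1; ring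
    have : (2 : PowerSeries ℝ) * (d⁄dX ℝ Y - C (4 * N) * (X * d⁄dX ℝ Y) + C (4 * N * (N - 2)) * (X * (X * d⁄dX ℝ Y))) =
      2 * (- C (2 * N) * Y + C (4 * N * (N - 2)) * (X * Y)) := by
      linear_combination e6 - c1 * Y
    have h2 : (2 : PowerSeries ℝ) ≠ 0 := by
      intro h
      have := congrArg PowerSeries.constantCoeff h
      rw [map_ofNat, map_zero] at this
      norm_num at this
    exact mul_left_cancel₀ h2 this
  have e8 : ∀ k, PowerSeries.coeff (k + 2) Y = - w k := by
    intro k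
    have : Y = 1 + C (2 * N) * X - C 2 * (B + X * B) := by
      rw [hY, show (C 2 : PowerSeries ℝ) = 2 from map_ofNat C 2]; ring
    rw [this, hw]
    simp only [B, map_add, map_sub, PowerSeries.coeff_C_mul, PowerSeries.coeff_succ_X_mul,
      PowerSeries.coeff_mk, PowerSeries.coeff_one, PowerSeries.coeff_X]
    simp
  have e9 := congrArg (PowerSeries.coeff (m + 3)) e7
  simp only [map_add, map_sub, neg_mul, map_neg, PowerSeries.coeff_C_mul, PowerSeries.coeff_succ_X_mul,
    PowerSeries.coeff_derivative, e8, show m + 3 + 1 = (m + 2) + 2 from rfl,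
    show m + 3 = (m + 1) + 2 from rfl, show m + 1 + 1 = m + 2 from rfl] at e9
  push_cast at e9
  linear_combination -e9


theorem ratio_limit {s : ℝ} (hs : 2 < s) {b l : ℕ → ℝ} (hl : ∀ m, l m = (if m = 0 then 1 else 0) +
      ∑ p ∈ antidiagonal m, b p.1 * l p.2)
    (hb0 : b 0 = 0)
    (hb : ∀ m, b (m + 1) = (if m = 0 then s ^ 2 else 0) + (l m - (if m = 0 then 1 else 0) - b m)) :
    (∀ᶠ m in atTop, 0 < b m) ∧
    Tendsto (fun m => b m / b (m + 1)) atTop (𝓝 (1 / (s * (s + 2)))) := by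
  have hs0 : 0 < s := by linarith
  set w : ℕ → ℝ := fun m => 2 * (b (m + 2) + b (m + 1)) with hw
  have hrec : ∀ m : ℕ, ((m : ℝ) + 4) * w (m + 2) = s ^ 2 * (2 * m + 5) * w (m + 1)
      - s ^ 2 * (s ^ 2 - 4) * (m + 1) * w m := by
    intro m
    have := w_rec (N := s ^ 2 / 2) hl hb0 (by intro m; rw [hb m]; split_ifs <;> ring) w
      (fun _ => rfl) m
    rw [this]; ring
  have hl0 : l 0 = 1 := by rw [hl]; simp [hb0]
  have hb1 : b 1 = s ^ 2 := by have := hb 0; simp [hl0, hb0] at this; exact this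
  have hl1 : l 1 = s ^ 2 := by
    rw [hl]; simp [Finset.Nat.antidiagonal_succ, hb0, hb1, hl0]
  have hb2 : b 2 = 0 := by have := hb 1; simp [hl1, hb1] at this; exact this
  have hl2 : l 2 = s ^ 4 := by
    rw [hl]; simp [Finset.Nat.antidiagonal_succ, hb0, hb1, hb2, hl0, hl1]; ring
  have hb3 : b 3 = s ^ 4 := by have := hb 2; simp [hl2, hb2] at this; exact this
  have hw0 : w 0 = 2 * s ^ 2 := by simp [hw, hb1, hb2]
  have hw1 : w 1 = 2 * s ^ 4 := by simp [hw, hb2, hb3]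
  -- error term
  set e : ℕ → ℝ := fun k => s * (s + 2) - w (k + 1) / w k with he
  have estep : ∀ k, 0 < w k → 0 ≤ e k → e k ≤ 2 * s →
      e (k + 1) = 6 * s / (k + 4) + (k + 1) / (k + 4) * (s * (s - 2) / (s * (s + 2) - e k)) * e k ∧
      0 < w (k + 1) := by
    intro k hk h0 h1
    have hr : w (k + 1) / w k = s * (s + 2) - e k := by simp [he]
    have hr0 : 0 < s * (s + 2) - e k := by nlinarith
    have hw' : w (k + 1) = (s * (s + 2) - e k) * w k := by rw [← hr]; field_simp
    have hpos : 0 < w (k + 1) := by rw [hw']; positivity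
    refine ⟨?_, hpos⟩
    have hk4 : (0 : ℝ) < k + 4 := by positivity
    have h2 : w (k + 2) = (s ^ 2 * (2 * k + 5) * w (k + 1)
      - s ^ 2 * (s ^ 2 - 4) * (k + 1) * w k) / (k + 4) := by
      rw [← hrec k]; field_simp
    have h3 : e (k + 1) = s * (s + 2) - (s ^ 2 * (2 * k + 5)
      - s ^ 2 * (s ^ 2 - 4) * (k + 1) / (s * (s + 2) - e k)) / (k + 4) := by
      change s * (s + 2) - w (k + 2) / w (k + 1) = _
      rw [h2, hw']
      field_simp
    rw [h3]
    field_simp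
    ring
  have hinv : ∀ k, 0 < w k ∧ 0 ≤ e k ∧ e k ≤ 2 * s := by
    intro k
    induction k with
    | zero =>
      have : e 0 = 2 * s := by
        simp only [he, hw0, zero_add, hw1]
        field_simp
        ring
      exact ⟨by rw [hw0]; positivity, by rw [this]; positivity, this.le⟩
    | succ k ih =>
      obtain ⟨h1, h2, h3⟩ := ih
      obtain ⟨h4, h5⟩ := estep k h1 h2 h3
      have hr0 : s ^ 2 ≤ s * (s + 2) - e k := by nlinarith
      have hq0 : 0 ≤ s * (s - 2) / (s * (s + 2) - e k) :=
        div_nonneg (by nlinarith) (by nlinarith)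
      have hq : s * (s - 2) / (s * (s + 2) - e k) ≤ (s - 2) / s := by
        rw [div_le_div_iff₀ (by nlinarith) hs0]
        nlinarith [mul_le_mul_of_nonneg_left hr0 (show 0 ≤ s - 2 by linarith)]
      refine ⟨h5, ?_, ?_⟩
      · rw [h4]; positivity
      · rw [h4]
        have hk4 : (0 : ℝ) < k + 4 := by positivity
        calc _ ≤ 6 * s / (k + 4) + (k + 1) / (k + 4) * ((s - 2) / s) * (2 * s) := by gcongr
          _ = (6 * s + (k + 1) * (s - 2) * 2) / (k + 4) := by field_simp
          _ ≤ 2 * s := by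
            rw [div_le_iff₀ hk4]
            have : (0 : ℝ) ≤ k := by positivity
            nlinarith
  have he0 : Tendsto e atTop (𝓝 0) := by
    refine tendsto_zero_of_contract (ε := fun k => 6 * s / ((k : ℝ) + 4)) (q := (s - 2) / s)
      (div_nonneg (by linarith) hs0.le) (by rw [div_lt_one hs0]; linarith) (fun k => (hinv k).2.1)
      (Eventually.of_forall fun k => ?_) ?_
    · obtain ⟨h1, h2, h3⟩ := hinv k
      obtain ⟨h4, h5⟩ := estep k h1 h2 h3
      have hr0 : s ^ 2 ≤ s * (s + 2) - e k := by nlinarith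
      have hq0 : 0 ≤ s * (s - 2) / (s * (s + 2) - e k) :=
        div_nonneg (by nlinarith) (by nlinarith)
      have hq : s * (s - 2) / (s * (s + 2) - e k) ≤ (s - 2) / s := by
        rw [div_le_div_iff₀ (by nlinarith) hs0]
        nlinarith [mul_le_mul_of_nonneg_left hr0 (show 0 ≤ s - 2 by linarith)]
      rw [h4]
      have h1' : ((k : ℝ) + 1) / (k + 4) ≤ 1 := by
        rw [div_le_one (by positivity)]; linarith
      have : ((k : ℝ) + 1) / (k + 4) * (s * (s - 2) / (s * (s + 2) - e k)) ≤ 1 * ((s - 2) / s) := by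
        gcongr
      rw [one_mul] at this
      gcongr
    · exact Tendsto.const_div_atTop (tendsto_atTop_add_const_right _ _ tendsto_natCast_atTop_atTop) _
  set ρ : ℝ := 1 / (s * (s + 2)) with hρ
  have hρ0 : 0 < ρ := by positivity
  have hρ1 : ρ < 1 := by rw [hρ, div_lt_one (by positivity)]; nlinarith
  have hwr : Tendsto (fun k => w k / w (k + 1)) atTop (𝓝 ρ) := by
    have h1 : Tendsto (fun k => s * (s + 2) - e k) atTop (𝓝 (s * (s + 2) - 0)) :=
      tendsto_const_nhds.sub he0
    rw [sub_zero] at h1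
    have h2 := h1.inv₀ (by positivity)
    rw [hρ, one_div]
    refine h2.congr (fun k => ?_)
    simp [he]
  -- ratio b / w
  set R : ℕ → ℝ := fun k => b (k + 2) / w k with hR
  set R0 : ℝ := 1 / (2 * (1 + ρ)) with hR0
  have hRrec : ∀ k, R (k + 1) = 1 / 2 - w k / w (k + 1) * R k := by
    intro k
    have h1 := (hinv k).1
    have h2 := (hinv (k + 1)).1
    have h3 : w (k + 1) = 2 * (b (k + 3) + b (k + 2)) := rfl
    simp only [hR]
    have : b (k + 1 + 2) = w (k + 1) / 2 - b (k + 2) := by rw [h3]; ring_nf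
    rw [this]
    field_simp
  have hx : Tendsto (fun k => |R k - R0|) atTop (𝓝 0) := by
    obtain ⟨q, hq1, hq2⟩ := exists_between hρ1
    refine tendsto_zero_of_contract (ε := fun k => |w k / w (k + 1) - ρ| * R0) (q := q)
      (hρ0.le.trans hq1.le) hq2 (fun k => abs_nonneg _) ?_ ?_
    · filter_upwards [hwr.eventually (gt_mem_nhds hq1)] with k hk
      have hpos : 0 < w k / w (k + 1) := div_pos (hinv k).1 (hinv (k + 1)).1
      have hR0' : R0 = 1 / 2 - ρ * R0 := by rw [hR0]; field_simp; ring
      have : R (k + 1) - R0 = -((w k / w (k + 1) - ρ) * R0) - (w k / w (k + 1)) * (R k - R0) := by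
        rw [hRrec]; linear_combination - hR0'
      rw [this]
      have hR0p : 0 < R0 := by positivity
      calc _ ≤ |-((w k / w (k + 1) - ρ) * R0)| + |(w k / w (k + 1)) * (R k - R0)| := abs_sub _ _
        _ = |w k / w (k + 1) - ρ| * R0 + (w k / w (k + 1)) * |R k - R0| := by
          rw [abs_neg, abs_mul, abs_mul, abs_of_pos hR0p, abs_of_pos hpos]
        _ ≤ _ := by gcongr
    · have h1 : Tendsto (fun k => |w k / w (k + 1) - ρ| * R0) atTop (𝓝 (|ρ - ρ| * R0)) :=
        ((hwr.sub_const ρ).abs).mul_const _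
      simpa using h1
  have hRl : Tendsto R atTop (𝓝 R0) := by
    rw [tendsto_iff_norm_sub_tendsto_zero]; exact hx
  have hR0p : 0 < R0 := by positivity
  have hbR : ∀ k, b (k + 2) = R k * w k := by
    intro k
    have := (hinv k).1
    simp only [hR]; field_simp
  have hpos : ∀ᶠ k in atTop, 0 < b (k + 2) := by
    filter_upwards [hRl.eventually (lt_mem_nhds hR0p)] with k hk
    rw [hbR]; exact mul_pos hk (hinv k).1
  refine ⟨(eventually_atTop_of_shift hpos), ?_⟩
  rw [← tendsto_add_atTop_iff_nat 2]
  have h1 : Tendsto (fun k => (R k / R (k + 1)) * (w k / w (k + 1))) atTop (𝓝 (R0 / R0 * ρ)) :=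
    (hRl.div (hRl.comp (tendsto_add_atTop_nat 1)) hR0p.ne').mul hwr
  rw [div_self hR0p.ne', one_mul] at h1
  refine h1.congr (fun k => ?_)
  have : k + 2 + 1 = (k + 1) + 2 := by ring
  rw [this, hbR, hbR]; exact (mul_div_mul_comm _ _ _ _).symm

end TreeAux

namespace TreeAux
open Finset Filter Topology AT

section totals
variable {X : Type*} {n : ℕ}

/-- number of `c`-admissible trees -/
noncomputable def bT (n : ℕ) (c : Bool) (m : ℕ) : ℕ := Set.ncard {t : AT n | Adm c t ∧ size t = m}
noncomputable def lT (n : ℕ) (c : Bool) (m : ℕ) : ℕ := Set.ncard {t : List (AT n) | AdmL c t ∧ sizeList t = m}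
noncomputable def rT (n : ℕ) (c : Bool) (m : ℕ) : ℕ := Set.ncard {t : AT n | Rtd c t ∧ size t = m}

variable [DecidableEq X] [Fintype X] (ι : X → Fin n → Bool)

theorem sum_tN (c : Bool) (m : ℕ) : ∑ d, tN ι c m d = bT n c m := sum_cnt _ (finP_tree _) m
theorem sum_lN (c : Bool) (m : ℕ) : ∑ d, lN ι c m d = lT n c m := sum_cnt _ (finP_list _) m
theorem sum_rN (c : Bool) (m : ℕ) : ∑ d, rN ι c m d = rT n c m := sum_cnt _ (finP_tree _) m

theorem sum_leafN : ∑ d, leafN ι d = 2 * n := by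
  classical
  have := Finset.card_eq_sum_card_fiberwise (s := (univ : Finset (Fin n × Bool)))
    (f := fun p => val ι (.leaf p.1 p.2)) (t := Finset.univ) (by simp)
  rw [Finset.card_univ] at this
  simp at this
  unfold leafN
  rw [mul_comm, this]
  refine Finset.sum_congr rfl (fun d _ => ?_)
  congr 1
  ext; simp

theorem sum_op {R : Type*} [CommSemiring R] (c : Bool) (F G : (X → Bool) → R) :
    ∑ d, ∑ g : X → Bool, ∑ h : X → Bool, (if op c g h = d then F g * G h else 0) =
      (∑ g, F g) * ∑ h, G h := by
  rw [Finset.sum_comm, Finset.sum_mul]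
  refine Finset.sum_congr rfl (fun g _ => ?_)
  rw [Finset.sum_comm, Finset.mul_sum]
  refine Finset.sum_congr rfl (fun h _ => ?_)
  simp

theorem lT_eq (n : ℕ) (c : Bool) (m : ℕ) : lT n c m = (if m = 0 then 1 else 0) +
    ∑ p ∈ antidiagonal m, bT n c p.1 * lT n c p.2 := by
  let ι : Unit → Fin n → Bool := fun _ _ => true
  rw [← sum_lN ι, Finset.sum_congr rfl (fun d _ => lN_eq ι c m d), Finset.sum_add_distrib,
    Finset.sum_comm]
  congr 1
  · by_cases h : m = 0 <;> simp [h]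
  · refine Finset.sum_congr rfl (fun p _ => ?_)
    rw [sum_op, sum_tN, sum_lN]

theorem lT_eq' (n : ℕ) (c : Bool) (m : ℕ) : lT n c m = (if m = 0 then 1 else 0) +
    bT n c m + rT n c (m + 1) := by
  let ι : Unit → Fin n → Bool := fun _ _ => true
  rw [← sum_lN ι, Finset.sum_congr rfl (fun d _ => rN_eq ι c m d), Finset.sum_add_distrib,
    Finset.sum_add_distrib, sum_tN, sum_rN]
  congr 2
  by_cases h : m = 0 <;> simp [h]

theorem bT_eq (n : ℕ) (c : Bool) (m : ℕ) : bT n (!c) m = (if m = 1 then 2 * n else 0) + rT n c m := by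
  let ι : Unit → Fin n → Bool := fun _ _ => true
  rw [← sum_tN ι, Finset.sum_congr rfl (fun d _ => tN_eq ι c m d), Finset.sum_add_distrib,
    sum_rN]
  congr 1
  by_cases h : m = 1 <;> simp [h, sum_leafN]

theorem bT_zero (n : ℕ) (c : Bool) : bT n c 0 = 0 := by
  let ι : Unit → Fin n → Bool := fun _ _ => true
  rw [← sum_tN ι]; simp [tN_zero]

theorem bT_symm_aux (n : ℕ) (m : ℕ) : (∀ c, bT n (!c) m = bT n c m) ∧ ∀ c, lT n (!c) m = lT n c m := by
  induction m using Nat.strong_induction_on with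
  | _ m ih =>
    have hb : ∀ c, bT n (!c) m = bT n c m := by
      rcases m with _ | k
      · simp [bT_zero]
      · intro c
        have h1 := bT_eq n c (k+1)
        have h2 := bT_eq n (!c) (k+1)
        rw [Bool.not_not] at h2
        have h3 := lT_eq' n c k
        have h4 := lT_eq' n (!c) k
        have h5 := (ih k (by omega)).1 c
        have h6 := (ih k (by omega)).2 c
        omega
    refine ⟨hb, fun c => ?_⟩
    rw [lT_eq, lT_eq n c]
    congr 1
    refine Finset.sum_congr rfl (fun p hp => ?_)
    rw [HasAntidiagonal.mem_antidiagonal] at hp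
    rcases Nat.eq_zero_or_pos p.1 with h0 | h0
    · rw [h0, bT_zero, bT_zero]; simp
    · rw [(ih p.2 (by omega)).2 c]
      rcases eq_or_lt_of_le (show p.1 ≤ m by omega) with h | h
      · rw [h, hb]
      · rw [(ih p.1 h).1]

theorem bT_symm (n : ℕ) (c : Bool) (m : ℕ) : bT n c m = bT n true m := by
  cases c
  · exact (bT_symm_aux n m).1 true
  · rfl
theorem lT_symm (n : ℕ) (c : Bool) (m : ℕ) : lT n c m = lT n true m := by
  cases c
  · exact (bT_symm_aux n m).2 true
  · rfl
theorem rT_eq (n : ℕ) (c : Bool) (m : ℕ) (hm : 2 ≤ m) : rT n c m = bT n true m := by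
  have := bT_eq n c m
  rw [if_neg (by omega), bT_symm] at this
  omega

/-- `√(2 * n)` -/
noncomputable def sq (n : ℕ) : ℝ := Real.sqrt (2 * n)
/-- the radius of convergence -/
noncomputable def rho (n : ℕ) : ℝ := 1 / (sq n * (sq n + 2))

theorem sq_sq (n : ℕ) : sq n ^ 2 = 2 * n := Real.sq_sqrt (by positivity)
theorem sq_gt (hn : 3 ≤ n) : 2 < sq n := by
  have : (3:ℝ) ≤ n := by exact_mod_cast hn
  apply Real.lt_sqrt_of_sq_lt; linarith
theorem rho_pos (hn : 3 ≤ n) : 0 < rho n := by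
  have := sq_gt hn
  unfold rho; positivity

theorem b_ratio (hn : 3 ≤ n) : (∀ᶠ m in atTop, (0:ℝ) < bT n true m) ∧
    Tendsto (fun m => (bT n true m : ℝ) / bT n true (m + 1)) atTop (𝓝 (rho n)) := by
  refine ratio_limit (s := sq n) (sq_gt hn) (l := fun m => (lT n true m : ℝ)) (b := fun m => (bT n true m : ℝ)) ?_ ?_ ?_
  · intro m; exact_mod_cast lT_eq n true m
  · simp [bT_zero]
  · intro m
    have h1 := bT_eq n false (m+1)
    have h2 := lT_eq' n false m
    rw [lT_symm, bT_symm] at h2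
    simp only [Bool.not_false] at h1
    rw [sq_sq]
    beta_reduce
    rw [h1, h2]
    by_cases h : m = 0 <;> simp [h]
    ring

end totals
end TreeAux

set_option linter.unusedSectionVars false
namespace TreeAux
open Finset Filter Topology AT

section gf
variable {X : Type*} {n : ℕ} [DecidableEq X] [Fintype X]

/-- convolution along a connective -/
noncomputable def conv (c : Bool) (F G : (X → Bool) → ℝ) (d : X → Bool) : ℝ :=
  ∑ g : X → Bool, ∑ h : X → Bool, if op c g h = d then F g * G h else 0

theorem sum_conv (c : Bool) (F G : (X → Bool) → ℝ) :
    ∑ d, conv c F G d = (∑ g, F g) * ∑ h, G h := sum_op c F G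

theorem conv_nonneg (c : Bool) {F G : (X → Bool) → ℝ} (hF : ∀ d, 0 ≤ F d) (hG : ∀ d, 0 ≤ G d)
    (d : X → Bool) : 0 ≤ conv c F G d := by
  unfold conv
  refine Finset.sum_nonneg (fun g _ => Finset.sum_nonneg (fun h _ => ?_))
  split_ifs
  · exact mul_nonneg (hF g) (hG h)
  · exact le_rfl

theorem conv_tsum (c : Bool) {r : ℝ} (a b : ℕ → (X → Bool) → ℝ)
    (hsa : ∀ d, Summable (fun m => a m d * r ^ m)) (hsb : ∀ d, Summable (fun m => b m d * r ^ m))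
    (d : X → Bool) :
    HasSum (fun m => (∑ p ∈ antidiagonal m, conv c (a p.1) (b p.2) d) * r ^ m)
      (conv c (fun g => ∑' m, a m g * r ^ m) (fun g => ∑' m, b m g * r ^ m) d) := by
  have e : ∀ m, (∑ p ∈ antidiagonal m, conv c (a p.1) (b p.2) d) * r ^ m =
      ∑ g : X → Bool, ∑ h : X → Bool, if op c g h = d then
        ∑ p ∈ antidiagonal m, (a p.1 g * r ^ p.1) * (b p.2 h * r ^ p.2) else 0 := by
    intro m
    unfold conv
    rw [Finset.sum_comm, Finset.sum_mul]
    refine Finset.sum_congr rfl (fun g _ => ?_)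
    rw [Finset.sum_comm, Finset.sum_mul]
    refine Finset.sum_congr rfl (fun h _ => ?_)
    split_ifs
    · rw [Finset.sum_mul]
      refine Finset.sum_congr rfl (fun p hp => ?_)
      rw [HasAntidiagonal.mem_antidiagonal] at hp
      rw [← hp, pow_add]; ring
    · simp
  simp_rw [e]
  unfold conv
  refine hasSum_sum (fun g _ => hasSum_sum (fun h _ => ?_))
  split_ifs
  · have h1 : Summable (fun m => ‖a m g * r ^ m‖) := (hsa g).norm
    have h2 : Summable (fun m => ‖b m h * r ^ m‖) := (hsb h).norm
    rw [tsum_mul_tsum_eq_tsum_sum_antidiagonal_of_summable_norm h1 h2]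
    exact (summable_norm_sum_mul_antidiagonal_of_summable_norm h1 h2).of_norm.hasSum
  · exact hasSum_zero

variable (ι : X → Fin n → Bool)

theorem rN_lower' (c : Bool) (m K : ℕ) (hm : 2 * K < m) (d : X → Bool) :
    ∑ k ∈ Finset.Icc 1 K, conv c (fun g => (qN ι c k g : ℝ)) (fun g => (tN ι c (m - k) g : ℝ)) d ≤
      rN ι c (m + 1) d := by
  have h := rN_lower ι c m K hm d
  have h' : (((∑ p ∈ antidiagonal m, ∑ g : X → Bool, ∑ h : X → Bool,
      (if op c g h = d then (if 1 ≤ p.1 ∧ p.1 ≤ K then qN ι c p.1 g else 0) * tN ι c p.2 h else 0) : ℕ)) : ℝ)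
      ≤ (rN ι c (m + 1) d : ℕ) := by exact_mod_cast h
  refine le_trans (le_of_eq ?_) h'
  rw [Finset.Nat.sum_antidiagonal_eq_sum_range_succ_mk]
  push_cast
  have : Finset.Icc 1 K ⊆ Finset.range (m + 1) := by
    intro k; simp; omega
  rw [← Finset.sum_subset this]
  · refine Finset.sum_congr rfl (fun k hk => ?_)
    rw [Finset.mem_Icc] at hk
    unfold conv
    refine Finset.sum_congr rfl (fun g _ => Finset.sum_congr rfl (fun h _ => ?_))
    rw [if_pos hk]
  · intro k _ hk
    rw [Finset.mem_Icc] at hk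
    refine Finset.sum_eq_zero (fun g _ => Finset.sum_eq_zero (fun h _ => ?_))
    rw [if_neg hk]; simp

theorem b_shift (hn : 3 ≤ n) (j : ℕ) :
    Tendsto (fun m => (bT n true m : ℝ) / bT n true (m + j)) atTop (𝓝 (rho n ^ j)) := by
  induction j with
  | zero =>
    refine tendsto_const_nhds.congr' ?_
    filter_upwards [(b_ratio hn).1] with m hm
    simp; rw [div_self hm.ne']
  | succ j ih =>
    have h1 := (b_ratio hn).2.comp (tendsto_add_atTop_nat j)
    rw [pow_succ]
    refine (ih.mul h1).congr' ?_
    have h2 := (tendsto_add_atTop_nat j).eventually (b_ratio hn).1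
    filter_upwards [h2] with m hm
    simp only [Function.comp]
    rw [div_mul_div_cancel₀ hm.ne', add_assoc]

theorem b_shift' (hn : 3 ≤ n) (K k : ℕ) (hk : k ≤ K) :
    Tendsto (fun m => (bT n true (m + K - k) : ℝ) / bT n true (m + K + 1)) atTop (𝓝 (rho n ^ (k + 1))) := by
  refine ((b_shift hn (k+1)).comp (tendsto_add_atTop_nat (K - k))).congr (fun m => ?_)
  simp only [Function.comp]
  rw [show m + (K - k) = m + K - k by omega, show m + K - k + (k + 1) = m + K + 1 by omega]

noncomputable def qT (n : ℕ) (c : Bool) (m : ℕ) : ℝ := ∑ p ∈ antidiagonal m, (lT n c p.1 : ℝ) * lT n c p.2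

theorem sum_qN (c : Bool) (m : ℕ) : ∑ d, (qN ι c m d : ℝ) = qT n c m := by
  have : ∑ d, qN ι c m d = ∑ p ∈ antidiagonal m, lT n c p.1 * lT n c p.2 := by
    rw [Finset.sum_congr rfl (fun d _ => qN_eq ι c m d), Finset.sum_comm]
    refine Finset.sum_congr rfl (fun p _ => ?_)
    rw [sum_op, sum_lN, sum_lN]
  unfold qT
  exact_mod_cast this

theorem qT_nonneg (n : ℕ) (c : Bool) (m : ℕ) : 0 ≤ qT n c m :=
  Finset.sum_nonneg (fun _ _ => by positivity)

theorem qT_bound (hn : 3 ≤ n) (c : Bool) (K : ℕ) :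
    ∑ k ∈ Finset.Icc 1 K, qT n c k * rho n ^ (k + 1) ≤ 1 := by
  let ι : Unit → Fin n → Bool := fun _ _ => true
  have h1 : ∀ m, 2 * K < m → ∑ k ∈ Finset.Icc 1 K, qT n c k * bT n true (m - k) ≤ bT n true (m + 1) := by
    intro m hm
    have h2 := Finset.sum_le_sum (s := univ) (fun d _ => rN_lower' ι c m K hm d)
    rw [Finset.sum_comm] at h2
    have h3 : ∑ d, (rN ι c (m+1) d : ℝ) = bT n true (m + 1) := by
      rw [← rT_eq n c (m+1) (by omega), ← sum_rN ι]; push_cast; rfl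
    rw [h3] at h2
    refine le_trans (le_of_eq ?_) h2
    refine Finset.sum_congr rfl (fun k _ => ?_)
    rw [sum_conv, sum_qN, ← bT_symm n c, ← sum_tN ι]; push_cast; rfl
  have h4 : Tendsto (fun m => ∑ k ∈ Finset.Icc 1 K, qT n c k * ((bT n true (m + K - k) : ℝ) / bT n true (m + K + 1)))
      atTop (𝓝 (∑ k ∈ Finset.Icc 1 K, qT n c k * rho n ^ (k + 1))) := by
    refine tendsto_finsetSum _ (fun k hk => ?_)
    rw [Finset.mem_Icc] at hk
    exact (b_shift' hn K k hk.2).const_mul _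
  refine le_of_tendsto h4 ?_
  filter_upwards [eventually_gt_atTop (2*K), (tendsto_add_atTop_nat (K+1)).eventually (b_ratio hn).1] with m hm hb
  rw [← add_assoc] at hb
  have := h1 (m+K) (by omega)
  simp_rw [← mul_div_assoc]
  rw [← Finset.sum_div, div_le_one hb]
  exact this

theorem qT_summable (hn : 3 ≤ n) (c : Bool) : Summable (fun k => qT n c k * rho n ^ k) := by
  have hr := rho_pos hn
  rw [← summable_nat_add_iff 1]
  refine summable_of_sum_range_le (c := 1 / rho n) (fun k => mul_nonneg (qT_nonneg _ _ _) (by positivity)) (fun K => ?_)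
  have := qT_bound hn c K
  rw [le_div_iff₀ hr, Finset.sum_mul]
  refine le_trans (le_of_eq ?_) this
  rw [Finset.range_eq_Ico, Finset.sum_Ico_add' (fun k => qT n c k * rho n ^ k * rho n) 0 K 1]
  refine Finset.sum_congr ?_ (fun k _ => by ring)
  ext k; simp

theorem lT_zero (n : ℕ) (c : Bool) : lT n c 0 = 1 := by
  rw [lT_eq]; simp [bT_zero]

theorem lT_le_qT (n : ℕ) (c : Bool) (m : ℕ) : (lT n c m : ℝ) ≤ qT n c m := by
  have := Finset.single_le_sum (s := antidiagonal m) (f := fun p => (lT n c p.1 : ℝ) * lT n c p.2)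
    (fun _ _ => by positivity) (a := (0, m)) (by simp)
  simpa [lT_zero, qT] using this

theorem qN_summable (hn : 3 ≤ n) (c : Bool) (d : X → Bool) :
    Summable (fun m => (qN ι c m d : ℝ) * rho n ^ m) := by
  have hr := rho_pos hn
  refine (qT_summable hn c).of_nonneg_of_le (fun _ => by positivity) (fun m => ?_)
  refine mul_le_mul_of_nonneg_right ?_ (by positivity)
  rw [← sum_qN ι]
  exact Finset.single_le_sum (f := fun d => (qN ι c m d : ℝ)) (fun _ _ => by positivity) (Finset.mem_univ d)

theorem lN_summable (hn : 3 ≤ n) (c : Bool) (d : X → Bool) :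
    Summable (fun m => (lN ι c m d : ℝ) * rho n ^ m) := by
  have hr := rho_pos hn
  refine (qT_summable hn c).of_nonneg_of_le (fun _ => by positivity) (fun m => ?_)
  refine mul_le_mul_of_nonneg_right ?_ (by positivity)
  refine le_trans ?_ (lT_le_qT n c m)
  rw [← sum_lN ι]
  exact_mod_cast Finset.single_le_sum (f := fun d => lN ι c m d) (fun _ _ => by positivity) (Finset.mem_univ d)

theorem tN_summable (hn : 3 ≤ n) (c : Bool) (d : X → Bool) :
    Summable (fun m => (tN ι c m d : ℝ) * rho n ^ m) := by
  have hr := rho_pos hn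
  refine (lN_summable ι hn c d).of_nonneg_of_le (fun _ => by positivity) (fun m => ?_)
  refine mul_le_mul_of_nonneg_right ?_ (by positivity)
  have := rN_eq ι c m d
  exact_mod_cast (by omega : tN ι c m d ≤ lN ι c m d)

noncomputable def phi (c : Bool) (d : X → Bool) : ℝ := ∑' m, (tN ι c m d : ℝ) * rho n ^ m
noncomputable def Ee (c : Bool) (d : X → Bool) : ℝ := ∑' m, (lN ι c m d : ℝ) * rho n ^ m
noncomputable def Qq (c : Bool) (d : X → Bool) : ℝ := ∑' m, (qN ι c m d : ℝ) * rho n ^ m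

theorem phi_nonneg (hn : 3 ≤ n) (c : Bool) (d : X → Bool) : 0 ≤ phi ι c d :=
  tsum_nonneg (fun m => by have := rho_pos hn; positivity)
theorem Ee_nonneg (hn : 3 ≤ n) (c : Bool) (d : X → Bool) : 0 ≤ Ee ι c d :=
  tsum_nonneg (fun m => by have := rho_pos hn; positivity)
theorem Qq_nonneg (hn : 3 ≤ n) (c : Bool) (d : X → Bool) : 0 ≤ Qq ι c d :=
  tsum_nonneg (fun m => by have := rho_pos hn; positivity)

theorem hasSum_at_zero (x r : ℝ) :
    HasSum (fun m : ℕ => (if m = 0 then x else 0) * r ^ m) x := by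
  have := hasSum_ite_eq (0:ℕ) x
  convert this using 2 with m
  by_cases h : m = 0 <;> simp [h]

theorem hasSum_cg {f g : ℕ → ℝ} {a : ℝ} (h : HasSum f a) (e : ∀ m, g m = f m) : HasSum g a := by
  rwa [show g = f from funext e]

theorem Ee_eq (hn : 3 ≤ n) (c : Bool) (d : X → Bool) :
    Ee ι c d = (if d = un c then 1 else 0) + conv c (phi ι c) (Ee ι c) d := by
  have h1 := conv_tsum c (fun m d => (tN ι c m d : ℝ)) (fun m d => (lN ι c m d : ℝ))
    (tN_summable ι hn c) (lN_summable ι hn c) d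
  have h2 := (hasSum_at_zero (if d = un c then 1 else 0) (rho n)).add h1
  refine (lN_summable ι hn c d).hasSum.unique (hasSum_cg h2 (fun m => ?_))
  rw [← add_mul, lN_eq]
  congr 1
  push_cast
  unfold conv
  congr 1
  by_cases h : m = 0 <;> simp [h]

theorem Qq_eq (hn : 3 ≤ n) (c : Bool) (d : X → Bool) :
    Qq ι c d = conv c (Ee ι c) (Ee ι c) d := by
  have h1 := conv_tsum c (fun m d => (lN ι c m d : ℝ)) (fun m d => (lN ι c m d : ℝ))
    (lN_summable ι hn c) (lN_summable ι hn c) d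
  refine (qN_summable ι hn c d).hasSum.unique (hasSum_cg h1 (fun m => ?_))
  rw [qN_eq]
  congr 1
  push_cast
  unfold conv
  rfl

theorem phi_eq (hn : 3 ≤ n) (c : Bool) (d : X → Bool) :
    phi ι (!c) d = leafN ι d * rho n + rho n * (Ee ι c d - (if d = un c then 1 else 0) - phi ι c d) := by
  have h1 := (((hasSum_at_zero (leafN ι d : ℝ) (rho n)).add (lN_summable ι hn c d).hasSum).sub
    (hasSum_at_zero (if d = un c then 1 else 0) (rho n))).sub (tN_summable ι hn c d).hasSum
  have h2 := h1.mul_left (rho n)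
  have h3 : HasSum (fun m => (tN ι (!c) (m+1) d : ℝ) * rho n ^ (m+1)) (phi ι (!c) d) := by
    rw [hasSum_nat_add_iff (f := fun m => (tN ι (!c) m d : ℝ) * rho n ^ m) 1]
    simpa [tN_zero, phi] using (tN_summable ι hn (!c) d).hasSum
  refine (h3.unique (hasSum_cg h2 (fun m => ?_))).trans ?_
  · have e1 := tN_eq ι c (m+1) d
    have e2 := rN_eq ι c m d
    rw [e1, e2]
    by_cases h : m = 0 <;> by_cases h' : d = un c <;> simp [h, h'] <;> ring
  · unfold Ee phi; ring

theorem sum_phi_tsum (hn : 3 ≤ n) (c : Bool) : ∑ d, phi ι c d = ∑' m, (bT n true m : ℝ) * rho n ^ m := by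
  unfold phi
  rw [← Summable.tsum_finsetSum (fun d _ => tN_summable ι hn c d)]
  refine tsum_congr (fun m => ?_)
  rw [← Finset.sum_mul, ← bT_symm n c, ← sum_tN ι]; push_cast; rfl

theorem sum_phi_Ee (hn : 3 ≤ n) (c : Bool) :
    ∑ d, phi ι c d = sq n / (sq n + 1) ∧ ∑ d, Ee ι c d = sq n + 1 := by
  have hs := sq_gt hn
  have hs2 := sq_sq n
  have h1 : ∑ d, Ee ι c d = 1 + (∑ d, phi ι c d) * ∑ d, Ee ι c d := by
    rw [← sum_conv c, ← Fintype.sum_ite_eq (un c : X → Bool) (fun _ => (1:ℝ)), ← Finset.sum_add_distrib]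
    refine Finset.sum_congr rfl (fun d _ => ?_)
    rw [Ee_eq ι hn]; simp only [eq_comm]
  have h2 : ∑ d, phi ι (!c) d = 2 * n * rho n + rho n * (∑ d, Ee ι c d - 1 - ∑ d, phi ι c d) := by
    rw [Finset.sum_congr rfl (fun d _ => phi_eq ι hn c d), Finset.sum_add_distrib, ← Finset.sum_mul,
      ← Finset.mul_sum, Finset.sum_sub_distrib, Finset.sum_sub_distrib]
    have := sum_leafN ι
    have h3 : ∑ d, (leafN ι d : ℝ) = 2 * n := by exact_mod_cast this
    rw [h3]
    simp
  rw [sum_phi_tsum ι hn (!c), ← sum_phi_tsum ι hn c] at h2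
  set B := ∑ d, phi ι c d
  set S := ∑ d, Ee ι c d
  set s := sq n
  have hB : (B * (s + 1) - s) ^ 2 = 0 := by
    unfold rho at h2
    rw [← hs2] at h2
    change B = s ^ 2 * (1 / (s * (s + 2))) + 1 / (s * (s + 2)) * (S - 1 - B) at h2
    have hs0 : s * (s + 2) ≠ 0 := by positivity
    field_simp at h2
    have : S = B * (s * (s+2)) - s ^ 2 + 1 + B := by linarith
    rw [this] at h1
    linear_combination -h1
  have hB' : B * (s + 1) = s := by
    have := pow_eq_zero_iff (two_ne_zero) |>.1 hB
    linarith
  have hB2 : B = s / (s + 1) := by rw [eq_div_iff (by positivity)]; exact hB'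
  refine ⟨hB2, ?_⟩
  rw [hB2] at h1
  have : s + 1 ≠ 0 := by positivity
  field_simp at h1
  linarith

theorem sum_Qq (hn : 3 ≤ n) (c : Bool) : ∑ d, Qq ι c d = (sq n + 1) ^ 2 := by
  rw [Finset.sum_congr rfl (fun d _ => Qq_eq ι hn c d), sum_conv, (sum_phi_Ee ι hn c).2]; ring

theorem rho_crit (hn : 3 ≤ n) : rho n * ((sq n + 1) ^ 2 - 1) = 1 := by
  have := sq_gt hn
  unfold rho
  field_simp
  ring

end gf
end TreeAux

set_option linter.unusedSectionVars false
namespace TreeAux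
open Finset Filter Topology AT

theorem exists_low (u : ℕ → ℝ) (h0 : ∀ m, 0 ≤ u m) (h1 : ∀ m, u m ≤ 1) :
    ∃ (v : ℕ → ℝ) (I : ℝ), (∀ m m', m ≤ m' → v m ≤ u m') ∧ Tendsto v atTop (𝓝 I) ∧
      (∀ m, 0 ≤ v m) ∧ ∀ (a : ℝ) (x : ℕ → ℝ) (j : ℕ), Tendsto x atTop (𝓝 a) →
        (∀ᶠ m in atTop, x m ≤ u (m + j)) → a ≤ I := by
  have hbd : ∀ m, BddBelow (Set.range (fun i => u (m + i))) := fun m =>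
    ⟨0, by rintro _ ⟨i, rfl⟩; exact h0 _⟩
  set v : ℕ → ℝ := fun m => ⨅ i, u (m + i) with hv
  have hvle : ∀ m m', m ≤ m' → v m ≤ u m' := by
    intro m m' h
    have := ciInf_le (hbd m) (m' - m)
    rwa [Nat.add_sub_cancel' h] at this
  have hmono : Monotone v := by
    intro m m' h
    refine le_ciInf (fun i => hvle _ _ (by omega))
  have hub : BddAbove (Set.range v) := ⟨1, by
    rintro _ ⟨m, rfl⟩; exact (hvle m m le_rfl).trans (h1 m)⟩
  refine ⟨v, ⨆ m, v m, hvle, tendsto_atTop_ciSup hmono hub, fun m => le_ciInf (fun i => h0 _), ?_⟩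
  intro a x j hx hxu
  refine le_of_forall_lt (fun b hb => ?_)
  obtain ⟨b', hb1, hb2⟩ := exists_between hb
  have h3 : ∀ᶠ m in atTop, b' ≤ u (m + j) := by
    filter_upwards [hx.eventually (lt_mem_nhds hb2), hxu] with m h4 h5
    exact h4.le.trans h5
  obtain ⟨N, hN⟩ := eventually_atTop.1 h3
  have : b' ≤ v (N + j) := le_ciInf (fun i => by
    have := hN (N + i) (by omega)
    rwa [show N + j + i = N + i + j by omega])
  exact hb1.trans_le (this.trans (le_ciSup hub (N + j)))

section lim
variable {X : Type*} {n : ℕ} [DecidableEq X] [Fintype X]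

theorem conv_abs_ge (c : Bool) {F G : (X → Bool) → ℝ} (hF : ∀ d, 0 ≤ F d) (hG : ∀ d, 0 ≤ G d) :
    F (un (!c)) * ∑ g, G g ≤ conv c F G (un (!c)) := by
  unfold conv
  rw [Finset.mul_sum]
  refine le_trans (le_of_eq ?_) (Finset.single_le_sum (f := fun g => ∑ h : X → Bool, if op c g h = un (!c) then F g * G h else 0)
    (fun g _ => Finset.sum_nonneg (fun h _ => ?_)) (Finset.mem_univ (un (!c))))
  · simp
  · split_ifs
    · exact mul_nonneg (hF g) (hG h)
    · exact le_rfl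

theorem conv_add_right (c : Bool) (F G H : (X → Bool) → ℝ) (d : X → Bool) :
    conv c F (fun g => G g + H g) d = conv c F G d + conv c F H d := by
  unfold conv
  rw [← Finset.sum_add_distrib]
  refine Finset.sum_congr rfl (fun g _ => ?_)
  rw [← Finset.sum_add_distrib]
  refine Finset.sum_congr rfl (fun h _ => ?_)
  split_ifs <;> ring

theorem conv_smul_right (c : Bool) (F G : (X → Bool) → ℝ) (r : ℝ) (d : X → Bool) :
    conv c F (fun g => G g * r) d = conv c F G d * r := by
  unfold conv
  rw [Finset.sum_mul]
  refine Finset.sum_congr rfl (fun g _ => ?_)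
  rw [Finset.sum_mul]
  refine Finset.sum_congr rfl (fun h _ => ?_)
  split_ifs <;> ring

theorem conv_tendsto {α : Type*} {l : Filter α} (c : Bool) {F G : α → (X → Bool) → ℝ} {F' G' : (X → Bool) → ℝ}
    (hF : ∀ d, Tendsto (fun a => F a d) l (𝓝 (F' d))) (hG : ∀ d, Tendsto (fun a => G a d) l (𝓝 (G' d))) (d : X → Bool) :
    Tendsto (fun a => conv c (F a) (G a) d) l (𝓝 (conv c F' G' d)) := by
  unfold conv
  refine tendsto_finsetSum _ (fun g _ => tendsto_finsetSum _ (fun h _ => ?_))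
  split_ifs
  · exact (hF g).mul (hG h)
  · exact tendsto_const_nhds

theorem conv_lower (c : Bool) {F u v : (X → Bool) → ℝ} (hF : ∀ d, 0 ≤ F d) (huv : ∀ d, v d ≤ u d)
    (d : X → Bool) :
    conv c F v d + (if d = un (!c) then F (un (!c)) * (∑ g, u g - ∑ g, v g) else 0) ≤ conv c F u d := by
  have h1 : conv c F u d = conv c F v d + conv c F (fun g => u g - v g) d := by
    rw [← conv_add_right]; congr 1; funext g; ring
  rw [h1]
  have h2 : ∀ g, 0 ≤ u g - v g := fun g => sub_nonneg.2 (huv g)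
  split_ifs with h
  · subst h
    have := conv_abs_ge c hF h2
    rw [Finset.sum_sub_distrib] at this
    linarith
  · have := conv_nonneg c hF h2 d
    linarith

variable (ι : X → Fin n → Bool)

theorem rN_le (c : Bool) (m : ℕ) (d : X → Bool) : rN ι c m d ≤ bT n true m := by
  have h1 := tN_eq ι c m d
  have h2 := Finset.single_le_sum (f := fun d => tN ι (!c) m d) (fun _ _ => by positivity) (Finset.mem_univ d)
  have h3 := sum_tN ι (!c) m
  rw [bT_symm] at h3
  omega

theorem qN_abs_pos (hn : 3 ≤ n) (c : Bool) : 0 < qN ι c 2 (un (!c)) := by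
  unfold qN cnt
  rw [Set.ncard_pos ((finP_pair _).fin _ _ _)]
  refine ⟨([.leaf ⟨0, by omega⟩ true, .leaf ⟨0, by omega⟩ false], []), ?_, ?_, ?_⟩
  · simp [AdmL, Adm, rootConn, WF.leaf]
  · simp
  · funext x; cases c <;> simp [op, un, val, eval]

theorem qN_zero (c : Bool) (d : X → Bool) : qN ι c 0 d = if d = un c then 1 else 0 := by
  rw [qN_eq]
  simp only [HasAntidiagonal.antidiagonal_zero, Finset.sum_singleton, lN_zero]
  by_cases h : d = un c
  · simp only [h, if_true]
    rw [Finset.sum_eq_single (un c), Finset.sum_eq_single (un c)] <;> simp +contextual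
  · simp only [h, if_false]
    refine Finset.sum_eq_zero (fun g _ => Finset.sum_eq_zero (fun g' _ => ?_))
    by_cases h1 : g = un c <;> by_cases h2 : g' = un c <;> simp [h1, h2]
    intro h3; exact h h3.symm

/-- `Q` without the trivial pair -/
noncomputable def Qp (c : Bool) (d : X → Bool) : ℝ := Qq ι c d - (if d = un c then 1 else 0)

theorem Qp_tendsto (hn : 3 ≤ n) (c : Bool) (d : X → Bool) :
    Tendsto (fun K => ∑ k ∈ Finset.Icc 1 K, (qN ι c k d : ℝ) * rho n ^ k) atTop (𝓝 (Qp ι c d)) := by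
  have h := (hasSum_nat_add_iff' (f := fun k => (qN ι c k d : ℝ) * rho n ^ k) 1).2 (qN_summable ι hn c d).hasSum
  have h2 := h.tendsto_sum_nat
  have e : ∑' (b : ℕ), (qN ι c b d : ℝ) * rho n ^ b - ∑ i ∈ range 1, (qN ι c i d : ℝ) * rho n ^ i = Qp ι c d := by
    simp [qN_zero, Qp, Qq]
  rw [e] at h2
  refine h2.congr (fun K => ?_)
  rw [Finset.range_eq_Ico, Finset.sum_Ico_add' (fun k => (qN ι c k d : ℝ) * rho n ^ k) 0 K 1]
  refine Finset.sum_congr ?_ (fun k _ => rfl)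
  ext k; simp

theorem Qp_nonneg (hn : 3 ≤ n) (c : Bool) (d : X → Bool) : 0 ≤ Qp ι c d :=
  ge_of_tendsto' (Qp_tendsto ι hn c d) (fun K => Finset.sum_nonneg (fun k _ => by
    have := rho_pos hn
    positivity))

theorem Qp_abs_pos (hn : 3 ≤ n) (c : Bool) : 0 < Qp ι c (un (!c)) := by
  have hr := rho_pos hn
  have h1 : (0:ℝ) < qN ι c 2 (un (!c)) * rho n ^ 2 := by
    have := qN_abs_pos ι hn c
    positivity
  refine h1.trans_le (ge_of_tendsto (Qp_tendsto ι hn c _) ?_)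
  filter_upwards [eventually_ge_atTop 2] with K hK
  exact Finset.single_le_sum (f := fun k => (qN ι c k (un (!c)) : ℝ) * rho n ^ k) (fun _ _ => by positivity)
    (by simp; omega)

theorem sum_Qp (hn : 3 ≤ n) (c : Bool) : rho n * ∑ d, Qp ι c d = 1 := by
  unfold Qp
  rw [Finset.sum_sub_distrib, sum_Qq ι hn]
  simp [rho_crit hn]

set_option maxHeartbeats 1600000 in
theorem limit_exists (hn : 3 ≤ n) : ∃ p : Bool → (X → Bool) → ℝ,
    (∀ c d, Tendsto (fun m => (rN ι c m d : ℝ) / bT n true m) atTop (𝓝 (p c d))) ∧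
    (∀ c d, 0 ≤ p c d) ∧ (∀ c, ∑ d, p c d = 1) ∧
    ∀ c d, p c d = rho n * conv c (Qp ι c) (p (!c)) d := by
  have hr := rho_pos hn
  obtain ⟨hbpos, -⟩ := b_ratio hn
  set u : Bool → (X → Bool) → ℕ → ℝ := fun c d m => (rN ι c m d : ℝ) / bT n true m with hu
  have hu0 : ∀ c d m, 0 ≤ u c d m := fun c d m => by simp only [hu]; positivity
  have hu1 : ∀ c d m, u c d m ≤ 1 := fun c d m =>
    div_le_one_of_le₀ (by exact_mod_cast rN_le ι c m d) (by positivity)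
  have husum : ∀ c, ∀ m, 2 ≤ m → 0 < (bT n true m : ℝ) → ∑ d, u c d m = 1 := by
    intro c m hm hb
    simp only [hu]
    rw [← Finset.sum_div, div_eq_one_iff_eq hb.ne', ← rT_eq n c m hm, ← sum_rN ι]
    push_cast; rfl
  choose v I hvu hvI hv0 hmax using fun c d => exists_low (u c d) (hu0 c d) (hu1 c d)
  have hI0 : ∀ c d, 0 ≤ I c d := fun c d => ge_of_tendsto' (hvI c d) (hv0 c d)
  have hI1 : ∀ c, ∑ d, I c d ≤ 1 := by
    intro c
    refine le_of_tendsto (tendsto_finsetSum _ (fun d _ => hvI c d)) ?_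
    filter_upwards [hbpos, eventually_ge_atTop 2] with m h1 h2
    rw [← husum c m h2 h1]
    exact Finset.sum_le_sum (fun d _ => hvu c d m m le_rfl)
  -- main inequality, truncated
  have hK : ∀ c d K, ∑ k ∈ Finset.Icc 1 K, (conv c (fun g => (qN ι c k g : ℝ)) (I (!c)) d +
      (if d = un (!c) then (qN ι c k (un (!c)) : ℝ) * (1 - ∑ g, I (!c) g) else 0)) * rho n ^ (k + 1) ≤ I c d := by
    intro c d K
    refine hmax c d _ (fun M => ∑ k ∈ Finset.Icc 1 K, (conv c (fun g => (qN ι c k g : ℝ)) (fun g => v (!c) g M) d +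
      (if d = un (!c) then (qN ι c k (un (!c)) : ℝ) * (1 - ∑ g, v (!c) g M) else 0)) *
        ((bT n true (M + K - k) : ℝ) / bT n true (M + K + 1))) (K + 1) ?_ ?_
    · refine tendsto_finsetSum _ (fun k hk => Tendsto.mul (Tendsto.add ?_ ?_) ?_)
      · exact conv_tendsto c (F := fun _ g => (qN ι c k g : ℝ)) (G := fun M g => v (!c) g M)
          (F' := fun g => (qN ι c k g : ℝ)) (G' := I (!c)) (fun _ => tendsto_const_nhds) (fun g => hvI (!c) g) d
      · split_ifs
        · exact (tendsto_const_nhds.sub (tendsto_finsetSum _ (fun g _ => hvI (!c) g))).const_mul _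
        · exact tendsto_const_nhds
      · exact b_shift' hn K k (Finset.mem_Icc.1 hk).2
    · obtain ⟨N, hN⟩ := eventually_atTop.1 hbpos
      filter_upwards [eventually_ge_atTop (max N (K+2))] with M hM
      have hMN : N ≤ M := le_trans (le_max_left _ _) hM
      have hMK : K + 2 ≤ M := le_trans (le_max_right _ _) hM
      have hl := rN_lower' ι c (M + K) K (by omega) d
      have hb1 := hN (M + K + 1) (by omega)
      change _ ≤ (rN ι c (M + K + 1) d : ℝ) / bT n true (M + K + 1)
      simp_rw [← mul_div_assoc]
      rw [← Finset.sum_div]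
      refine div_le_div_of_nonneg_right (le_trans (Finset.sum_le_sum (fun k hk => ?_)) hl) hb1.le
      rw [Finset.mem_Icc] at hk
      have hbk := hN (M + K - k) (by omega)
      have e : conv c (fun g => (qN ι c k g : ℝ)) (fun g => (tN ι c (M + K - k) g : ℝ)) d =
          conv c (fun g => (qN ι c k g : ℝ)) (fun g => u (!c) g (M + K - k)) d * bT n true (M + K - k) := by
        rw [← conv_smul_right]
        congr 1
        funext g
        have := tN_eq ι (!c) (M + K - k) g
        rw [Bool.not_not, if_neg (by omega), zero_add] at this
        simp only [hu]
        rw [this, div_mul_cancel₀ _ hbk.ne']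
      rw [e]
      refine mul_le_mul_of_nonneg_right ?_ hbk.le
      have := conv_lower c (F := fun g => (qN ι c k g : ℝ)) (u := fun g => u (!c) g (M + K - k))
        (v := fun g => v (!c) g M) (fun _ => by positivity) (fun g => hvu (!c) g M _ (by omega)) d
      rw [husum (!c) _ (by omega) hbk] at this
      exact this
  -- main inequality
  have hmain : ∀ c d, rho n * (conv c (Qp ι c) (I (!c)) d +
      (if d = un (!c) then Qp ι c (un (!c)) * (1 - ∑ g, I (!c) g) else 0)) ≤ I c d := by
    intro c d
    refine le_of_tendsto' (x := atTop) (f := fun K => rho n * (conv c (fun g => ∑ k ∈ Finset.Icc 1 K, (qN ι c k g : ℝ) * rho n ^ k) (I (!c)) d +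
      (if d = un (!c) then (∑ k ∈ Finset.Icc 1 K, (qN ι c k (un (!c)) : ℝ) * rho n ^ k) * (1 - ∑ g, I (!c) g) else 0))) ?_ (fun K => ?_)
    · refine (Tendsto.add ?_ ?_).const_mul _
      · exact conv_tendsto c (F := fun K g => ∑ k ∈ Finset.Icc 1 K, (qN ι c k g : ℝ) * rho n ^ k)
          (G := fun _ g => I (!c) g) (F' := Qp ι c) (G' := I (!c)) (fun g => Qp_tendsto ι hn c g) (fun _ => tendsto_const_nhds) d
      · split_ifs
        · exact (Qp_tendsto ι hn c _).mul_const _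
        · exact tendsto_const_nhds
    · refine le_trans (le_of_eq ?_) (hK c d K)
      simp_rw [add_mul]
      rw [Finset.sum_add_distrib, mul_add]
      congr 1
      · unfold conv
        simp_rw [Finset.sum_mul]
        rw [Finset.sum_comm (s := Finset.Icc 1 K), Finset.mul_sum]
        refine Finset.sum_congr rfl (fun g _ => ?_)
        rw [Finset.sum_comm (s := Finset.Icc 1 K), Finset.mul_sum]
        refine Finset.sum_congr rfl (fun h _ => ?_)
        split_ifs
        · rw [Finset.mul_sum]
          refine Finset.sum_congr rfl (fun k _ => ?_)
          ring
        · simp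
      · split_ifs
        · rw [Finset.sum_mul, Finset.mul_sum]
          refine Finset.sum_congr rfl (fun k _ => ?_)
          ring
        · simp
  -- summation
  have hsig : ∀ c, (∑ d, I (!c) d) + rho n * Qp ι c (un (!c)) * (1 - ∑ d, I (!c) d) ≤ ∑ d, I c d := by
    intro c
    refine le_trans (le_of_eq ?_) (Finset.sum_le_sum (fun d _ => hmain c d))
    rw [← Finset.mul_sum, Finset.sum_add_distrib, sum_conv, mul_add, ← mul_assoc, sum_Qp ι hn]
    simp
    ring
  have hone : ∀ c, ∑ d, I c d = 1 := by
    intro c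
    have h1 := hsig c
    have h2 := hsig (!c)
    rw [Bool.not_not] at h2
    have e1 := mul_pos hr (Qp_abs_pos ι hn c)
    have e2 := mul_pos hr (Qp_abs_pos ι hn (!c))
    rw [Bool.not_not] at e2
    have g1 := hI1 c
    have g2 := hI1 (!c)
    have k1 := mul_nonneg e1.le (sub_nonneg.2 g2)
    have k2 := mul_nonneg e2.le (sub_nonneg.2 g1)
    have : ∑ d, I c d = ∑ d, I (!c) d := by linarith
    rw [← this] at h1
    by_contra hne
    have hlt : ∑ d, I c d < 1 := lt_of_le_of_ne g1 hne
    have := mul_pos e1 (sub_pos.2 hlt)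
    linarith
  refine ⟨I, fun c d => ?_, hI0, hone, fun c d => ?_⟩
  · have hup : Tendsto (fun m => 1 - ∑ g ∈ univ.erase d, v c g m) atTop (𝓝 (I c d)) := by
      have : I c d = 1 - ∑ g ∈ univ.erase d, I c g := by
        rw [← hone c, ← Finset.add_sum_erase _ _ (Finset.mem_univ d)]; ring
      rw [this]
      exact tendsto_const_nhds.sub (tendsto_finsetSum _ (fun g _ => hvI c g))
    refine tendsto_of_tendsto_of_tendsto_of_le_of_le' (hvI c d) hup (Eventually.of_forall (fun m => hvu c d m m le_rfl)) ?_
    filter_upwards [hbpos, eventually_ge_atTop 2] with m h1 h2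
    have h3 := husum c m h2 h1
    rw [← Finset.add_sum_erase _ _ (Finset.mem_univ d)] at h3
    have h4 : ∑ g ∈ univ.erase d, v c g m ≤ ∑ g ∈ univ.erase d, u c g m :=
      Finset.sum_le_sum (fun g _ => hvu c g m m le_rfl)
    change u c d m ≤ _
    linarith
  · have hle : ∀ d ∈ univ, rho n * conv c (Qp ι c) (I (!c)) d ≤ I c d := by
      intro d _
      have := hmain c d
      rw [hone (!c)] at this
      simpa using this
    refine ((Finset.sum_eq_sum_iff_of_le hle).1 ?_ d (Finset.mem_univ d)).symm
    rw [← Finset.mul_sum, sum_conv, ← mul_assoc, sum_Qp ι hn, hone, hone, mul_one]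

end lim
end TreeAux

set_option linter.unusedSectionVars false
namespace TreeAux
open Finset Filter Topology AT

section upper

/-- nonconstant -/
def NC {X : Type*} (d : X → Bool) : Prop := d ≠ un true ∧ d ≠ un false

theorem NC_iff {X : Type*} (c : Bool) (d : X → Bool) : NC d ↔ d ≠ un c ∧ d ≠ un (!c) := by
  cases c <;> simp [NC, and_comm]

section weights
variable {X : Type*} {n : ℕ} [DecidableEq X] [Fintype X] [Nonempty X]

theorem un_ne (c : Bool) : (un c : X → Bool) ≠ un (!c) := by
  intro h
  have := congrFun h (Classical.arbitrary X)
  cases c <;> simp [un] at this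

open Classical in
/-- weighted sum over nonconstant functions -/
noncomputable def Sw (W : ℝ) (e : (X → Bool) → ℕ) (F : (X → Bool) → ℝ) : ℝ :=
  ∑ d, if NC d then F d * W ^ e d else 0

theorem Sw_nonneg {W : ℝ} (hW : 1 ≤ W) (e : (X → Bool) → ℕ) {F : (X → Bool) → ℝ} (hF : ∀ d, 0 ≤ F d) :
    0 ≤ Sw W e F := by
  classical
  refine Finset.sum_nonneg (fun d _ => ?_)
  split_ifs
  · have := hF d; positivity
  · exact le_rfl

theorem Sw_mono {W : ℝ} (hW : 1 ≤ W) {e e' : (X → Bool) → ℕ} {F G : (X → Bool) → ℝ} (hF : ∀ d, 0 ≤ F d)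
    (he : ∀ d, e d ≤ e' d) (hFG : ∀ d, NC d → F d ≤ G d) :
    Sw W e F ≤ Sw W e' G := by
  classical
  refine Finset.sum_le_sum (fun d _ => ?_)
  split_ifs with h
  · have h1 := hFG d h
    have h2 := hF d
    have := pow_le_pow_right₀ hW (he d)
    gcongr
    linarith
  · exact le_rfl

theorem Sw_conv {W : ℝ} (hW : 1 ≤ W) (c : Bool) {e : (X → Bool) → ℕ} {F G : (X → Bool) → ℝ} (hF : ∀ d, 0 ≤ F d)
    (hG : ∀ d, 0 ≤ G d) (he : ∀ g h, e (op c g h) ≤ e g + e h) :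
    Sw W e (conv c F G) ≤ F (un c) * Sw W e G + Sw W e F * G (un c) + Sw W e F * Sw W e G := by
  classical
  have h1 : Sw W e (conv c F G) = ∑ g, ∑ h, if NC (op c g h) then F g * G h * W ^ e (op c g h) else 0 := by
    unfold Sw conv
    have : ∀ d, (if NC d then (∑ g, ∑ h, if op c g h = d then F g * G h else 0) * W ^ e d else 0) =
        ∑ g, ∑ h, if op c g h = d then (if NC d then F g * G h * W ^ e d else 0) else 0 := by
      intro d
      split_ifs with hd
      · rw [Finset.sum_mul]
        refine Finset.sum_congr rfl (fun g _ => ?_)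
        rw [Finset.sum_mul]
        refine Finset.sum_congr rfl (fun h _ => ?_)
        split_ifs <;> simp
      · simp
    rw [Finset.sum_congr rfl (fun d _ => this d), Finset.sum_comm]
    refine Finset.sum_congr rfl (fun g _ => ?_)
    rw [Finset.sum_comm]
    refine Finset.sum_congr rfl (fun h _ => ?_)
    simp
  set oF : (X → Bool) → ℝ := fun g => if g = un c then F g else 0 with hoF
  set oG : (X → Bool) → ℝ := fun g => if g = un c then G g else 0 with hoG
  set wF : (X → Bool) → ℝ := fun g => if NC g then F g * W ^ e g else 0 with hwF
  set wG : (X → Bool) → ℝ := fun g => if NC g then G g * W ^ e g else 0 with hwG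
  have hoF0 : ∀ g, 0 ≤ oF g := fun g => by simp only [hoF]; split_ifs; exacts [hF g, le_rfl]
  have hoG0 : ∀ g, 0 ≤ oG g := fun g => by simp only [hoG]; split_ifs; exacts [hG g, le_rfl]
  have hwF0 : ∀ g, 0 ≤ wF g := fun g => by
    simp only [hwF]; split_ifs; exacts [mul_nonneg (hF g) (by positivity), le_rfl]
  have hwG0 : ∀ g, 0 ≤ wG g := fun g => by
    simp only [hwG]; split_ifs; exacts [mul_nonneg (hG g) (by positivity), le_rfl]
  have h2 : ∀ g h, (if NC (op c g h) then F g * G h * W ^ e (op c g h) else 0) ≤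
      oF g * wG h + wF g * oG h + wF g * wG h := by
    intro g h
    have p1 := mul_nonneg (hoF0 g) (hwG0 h)
    have p2 := mul_nonneg (hwF0 g) (hoG0 h)
    have p3 := mul_nonneg (hwF0 g) (hwG0 h)
    split_ifs with hnc
    · by_cases hg : g = un c
      · subst hg
        rw [un_op] at hnc ⊢
        have : oF (un c) * wG h = F (un c) * G h * W ^ e h := by simp [hoF, hwG, hnc]; ring
        linarith
      · by_cases hh : h = un c
        · subst hh
          rw [op_un] at hnc ⊢
          have : wF g * oG (un c) = F g * G (un c) * W ^ e g := by simp [hoG, hwF, hnc]; ring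
          linarith
        · have n1 : NC g := (NC_iff c g).2 ⟨hg, fun h' => by
            subst h'
            rw [abs_op, NC_iff c] at hnc
            exact hnc.2 rfl⟩
          have n2 : NC h := (NC_iff c h).2 ⟨hh, fun h' => by
            subst h'
            rw [op_abs, NC_iff c] at hnc
            exact hnc.2 rfl⟩
          have e3 : wF g * wG h = F g * G h * W ^ (e g + e h) := by
            simp [hwF, hwG, n1, n2, pow_add]; ring
          have := mul_le_mul_of_nonneg_left (pow_le_pow_right₀ hW (he g h)) (mul_nonneg (hF g) (hG h))
          linarith
    · linarith
  have s1 : ∑ g, oF g = F (un c) := by simp [hoF]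
  have s2 : ∑ g, oG g = G (un c) := by simp [hoG]
  have s3 : ∑ g, wF g = Sw W e F := rfl
  have s4 : ∑ g, wG g = Sw W e G := rfl
  rw [h1]
  refine (Finset.sum_le_sum (fun g _ => Finset.sum_le_sum (fun h _ => h2 g h))).trans (le_of_eq ?_)
  rw [← s1, ← s2, ← s3, ← s4]
  simp_rw [Finset.sum_add_distrib, ← Finset.mul_sum, ← Finset.sum_mul]

theorem conv_one (c : Bool) (F G : (X → Bool) → ℝ) : conv c F G (un c) = F (un c) * G (un c) := by
  unfold conv
  rw [Finset.sum_eq_single (un c), Finset.sum_eq_single (un c)]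
  · simp
  · intro b _ hb
    rw [if_neg]
    exact fun h => hb (op_eq_un h).2
  · simp
  · intro b _ hb
    refine Finset.sum_eq_zero (fun h _ => ?_)
    rw [if_neg]
    exact fun h => hb (op_eq_un h).1
  · simp

end weights

section compl
variable {k : ℕ}

/-- truncated complexity -/
noncomputable def Lj (j : ℕ) (h : (Fin k → Bool) → Bool) : ℕ :=
  sInf ({j} ∪ {a | ∃ t : AT k, WF t ∧ size t = a ∧ eval t = h})
noncomputable def ej (c : Bool) (j : ℕ) (h : (Fin k → Bool) → Bool) : ℕ :=
  sInf ({j} ∪ {a | ∃ l : List (AT k), l ≠ [] ∧ AdmL c l ∧ sizeList l = a ∧ valL id c l = h})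

theorem Lj_mem (j : ℕ) (h : (Fin k → Bool) → Bool) : Lj j h = j ∨ ∃ t : AT k, WF t ∧ size t = Lj j h ∧ eval t = h :=
  Nat.sInf_mem (s := {j} ∪ {a | ∃ t : AT k, WF t ∧ size t = a ∧ eval t = h}) ⟨j, by simp⟩
theorem ej_mem (c : Bool) (j : ℕ) (h : (Fin k → Bool) → Bool) : ej c j h = j ∨
    ∃ l : List (AT k), l ≠ [] ∧ AdmL c l ∧ sizeList l = ej c j h ∧ valL id c l = h :=
  Nat.sInf_mem (s := {j} ∪ {a | ∃ l : List (AT k), l ≠ [] ∧ AdmL c l ∧ sizeList l = a ∧ valL id c l = h}) ⟨j, by simp⟩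
theorem Lj_le (j : ℕ) (h : (Fin k → Bool) → Bool) : Lj j h ≤ j := Nat.sInf_le (by simp)
theorem ej_le (c : Bool) (j : ℕ) (h : (Fin k → Bool) → Bool) : ej c j h ≤ j := Nat.sInf_le (by simp)
theorem Lj_le_size (j : ℕ) {t : AT k} (ht : WF t) : Lj j (eval t) ≤ size t :=
  Nat.sInf_le (Or.inr ⟨t, ht, rfl, rfl⟩)
theorem ej_le_size (c : Bool) (j : ℕ) {l : List (AT k)} (h0 : l ≠ []) (h : AdmL c l) : ej c j (valL id c l) ≤ sizeList l :=
  Nat.sInf_le (Or.inr ⟨l, h0, h, rfl, rfl⟩)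

theorem ej_op (c : Bool) (j : ℕ) (g h : (Fin k → Bool) → Bool) : ej c j (op c g h) ≤ ej c j g + ej c j h := by
  have h0 := ej_le c j (op c g h)
  rcases ej_mem c j g with h1 | ⟨l, a1, a2, a3, rfl⟩
  · omega
  rcases ej_mem c j h with h1 | ⟨l', b1, b2, b3, rfl⟩
  · omega
  rw [← a3, ← b3, ← valL_append, ← sizeList_append]
  refine ej_le_size c j (by simp [a1]) ?_
  intro t ht
  rcases List.mem_append.1 ht with h | h
  exacts [a2 t h, b2 t h]

theorem ej_le_Lj (c : Bool) (j : ℕ) (h : (Fin k → Bool) → Bool) : ej c j h ≤ Lj j h := by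
  rcases Lj_mem j h with h1 | ⟨t, h1, h2, rfl⟩
  · rw [h1]; exact ej_le c j h
  rw [← h2]
  by_cases hc : Rtd c t
  · obtain ⟨l, rfl, h3, h4⟩ := Rtd_iff.1 hc
    have := ej_le_size c j (l := l) (by rintro rfl; simp at h3) h4
    have e : valL id c l = eval (.node c l) := by funext x; simp [valL, eval]
    rw [e] at this
    simp
    omega
  · have := ej_le_size c j (l := [t]) (by simp) (by
      intro t' ht'
      simp at ht'; subst ht'
      exact ⟨h1, fun h => hc ⟨h1, h⟩⟩)
    have e : valL id c [t] = eval t := by simp; rfl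
    rw [e] at this
    simpa using this

theorem Lj_succ_le (c : Bool) (j : ℕ) (h : (Fin k → Bool) → Bool) : Lj (j + 1) h ≤ 1 + ej c j h := by
  rcases ej_mem c j h with h1 | ⟨l, h1, h2, h3, rfl⟩
  · rw [h1, add_comm]; exact Lj_le _ _
  rw [← h3]
  by_cases hl : 2 ≤ l.length
  · have := Lj_le_size (j+1) (Rtd_iff.2 ⟨l, rfl, hl, h2⟩ : Rtd c (.node c l)).1
    have e : valL id c l = eval (.node c l) := by funext x; simp [valL, eval]
    rw [← e] at this
    simpa using this
  · rcases l with _ | ⟨t, _ | ⟨t', l⟩⟩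
    · simp at h1
    · have := Lj_le_size (j+1) (h2 t (by simp)).1
      have e : valL id c [t] = eval t := by simp; rfl
      rw [← e] at this
      simp at this ⊢
      omega
    · simp at hl

theorem Lj_Lcomp {f : (Fin k → Bool) → Bool} (hf : 3 ≤ Lcomp k f) : Lj (Lcomp k f) f = Lcomp k f := by
  have h0 : Lcomp k f = sInf {m | ∃ t : AT k, WF t ∧ size t = m ∧ eval t = f} := by
    unfold Lcomp at hf ⊢
    split_ifs at hf ⊢ <;> omega
  refine le_antisymm (Lj_le _ _) ?_
  rcases Lj_mem (Lcomp k f) f with h | ⟨t, h1, h2, h3⟩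
  · exact h.ge
  · rw [← h2, h0]
    exact Nat.sInf_le ⟨t, h1, rfl, h3⟩

end compl
end upper
end TreeAux

set_option linter.unusedSectionVars false
namespace TreeAux
open Finset Filter Topology AT

section upper2

/-- restriction to the first `k` variables, all others being set to true -/
def rest (k n : ℕ) (x : Fin k → Bool) (i : Fin n) : Bool := if h : i.val < k then x ⟨i.val, h⟩ else true

section gen
variable {X : Type*} {n : ℕ} [DecidableEq X] [Fintype X] [Nonempty X] (ι : X → Fin n → Bool)

/-- mass of rooted trees -/
noncomputable def Rm (c : Bool) (d : X → Bool) : ℝ := rho n * (Ee ι c d - (if d = un c then 1 else 0) - phi ι c d)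

theorem Rm_nonneg (hn : 3 ≤ n) (c : Bool) (d : X → Bool) : 0 ≤ Rm ι c d := by
  have h1 := phi_eq ι hn c d
  have h2 : (tN ι (!c) 1 d : ℝ) * rho n ^ 1 ≤ phi ι (!c) d :=
    (tN_summable ι hn (!c) d).le_tsum 1 (fun m _ => by have := rho_pos hn; positivity)
  have h3 := tN_eq ι c 1 d
  have h4 : (leafN ι d : ℝ) ≤ tN ι (!c) 1 d := by
    exact_mod_cast (by simp at h3; omega)
  have := mul_le_mul_of_nonneg_right h4 (rho_pos hn).le
  unfold Rm
  rw [pow_one] at h2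
  linarith

theorem phi_eq' (hn : 3 ≤ n) (c : Bool) (d : X → Bool) : phi ι c d = leafN ι d * rho n + Rm ι (!c) d := by
  have := phi_eq ι hn (!c) d
  rw [Bool.not_not] at this
  exact this

theorem sum_Rm (hn : 3 ≤ n) (c : Bool) : ∑ d, Rm ι c d ≤ 1 / sq n := by
  have hs := sq_gt hn
  have hs2 := sq_sq n
  unfold Rm
  rw [← Finset.mul_sum, Finset.sum_sub_distrib, Finset.sum_sub_distrib, (sum_phi_Ee ι hn c).1, (sum_phi_Ee ι hn c).2]
  simp
  unfold rho
  rw [div_mul_eq_mul_div, div_le_iff₀ (by positivity)]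
  have : (sq n)⁻¹ * (sq n * (sq n + 2)) = sq n + 2 := by field_simp
  rw [this]
  have : 0 ≤ sq n / (sq n + 1) := by positivity
  linarith

theorem Rm_le (hn : 3 ≤ n) (c : Bool) (d : X → Bool) : Rm ι c d ≤ 1 / sq n :=
  (Finset.single_le_sum (fun d _ => Rm_nonneg ι hn c d) (Finset.mem_univ d)).trans (sum_Rm ι hn c)

theorem rho_le (hn : 3 ≤ n) : rho n ≤ 1 / (2 * n) := by
  have hs := sq_gt hn
  have hs2 := sq_sq n
  unfold rho
  rw [← hs2]
  apply one_div_le_one_div_of_le (by positivity)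
  nlinarith

theorem leafN_un_le (c : Bool) : leafN ι (un c : X → Bool) ≤ n := by
  classical
  unfold leafN
  refine (Finset.card_le_card_of_injOn (t := (univ : Finset (Fin n))) (fun p => p.1) (by simp) ?_).trans (by simp)
  rintro ⟨i, b⟩ h ⟨i', b'⟩ h' e
  simp at h h' e
  subst e
  have h1 := congrFun h (Classical.arbitrary X)
  have h2 := congrFun h' (Classical.arbitrary X)
  simp [val, eval, un] at h1 h2
  cases b <;> cases b' <;> simp at h1 h2 ⊢ <;> simp [h1] at h2

theorem phi_one_le (hn : 128 ≤ n) (c : Bool) : phi ι c (un c) ≤ 5 / 8 := by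
  have hn3 : 3 ≤ n := by omega
  have hnR : (128:ℝ) ≤ n := by exact_mod_cast hn
  have h16 : 16 ≤ sq n := by apply Real.le_sqrt_of_sq_le; linarith
  rw [phi_eq' ι hn3]
  have h1 := Rm_le ι hn3 (!c) (un c)
  have h2 : (1:ℝ) / sq n ≤ 1 / 16 := one_div_le_one_div_of_le (by norm_num) h16
  have h3 : (leafN ι (un c : X → Bool) : ℝ) ≤ n := by exact_mod_cast leafN_un_le ι c
  have h4 := mul_le_mul h3 (rho_le hn3) (rho_pos hn3).le (by positivity)
  have h5 : (n:ℝ) * (1 / (2 * n)) = 1 / 2 := by field_simp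
  linarith

end gen

variable {k n : ℕ}

theorem leaf_nc (i : Fin n) (b : Bool) (h : NC (val (rest k n) (.leaf i b))) : i.val < k := by
  by_contra hi
  have : val (rest k n) (.leaf i b) = un b := by
    funext x; simp [val, eval, rest, hi, un]
  rw [this] at h
  cases b <;> simp [NC] at h

open Classical in
theorem sum_leaf_nc : ∑ d : (Fin k → Bool) → Bool, (if NC d then leafN (rest k n) d else 0) ≤ 2 * k := by
  have h1 : ∀ d : (Fin k → Bool) → Bool, (if NC d then leafN (rest k n) d else 0) =
      ∑ p : Fin n × Bool, if val (rest k n) (.leaf p.1 p.2) = d then (if NC d then 1 else 0) else 0 := by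
    intro d
    unfold leafN
    split_ifs
    · rw [Finset.card_filter]
      refine Finset.sum_congr rfl (fun p _ => ?_)
      split_ifs <;> rfl
    · simp
  rw [Finset.sum_congr rfl (fun d _ => h1 d), Finset.sum_comm]
  simp only [Finset.sum_ite_eq, Finset.mem_univ, if_true]
  rw [← Finset.card_filter]
  have : 2 * k = Fintype.card (Fin k × Bool) := by simp [mul_comm]
  rw [this, ← Finset.card_univ]
  rcases Nat.eq_zero_or_pos k with hk | hk
  · subst hk
    refine le_of_eq_of_le (Finset.card_eq_zero.2 ?_) (Nat.zero_le _)
    ext p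
    simp
    intro h
    have := leaf_nc _ _ h
    omega
  refine Finset.card_le_card_of_injOn (fun p => (if h : p.1.val < k then ⟨p.1.val, h⟩ else ⟨0, hk⟩, p.2)) (by simp) ?_
  rintro ⟨i, b⟩ h ⟨i', b'⟩ h' e
  simp at h h' e
  have h1 := leaf_nc _ _ h
  have h2 := leaf_nc _ _ h'
  simp [h1, h2] at e
  ext <;> simp [e]

theorem leaf_Lj (j : ℕ) (d : (Fin k → Bool) → Bool) (hd : NC d) (hl : leafN (rest k n) d ≠ 0) : Lj j d ≤ 1 := by
  classical
  unfold leafN at hl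
  obtain ⟨⟨i, b⟩, h⟩ := Finset.card_ne_zero.1 hl
  simp at h
  subst h
  have hi := leaf_nc _ _ hd
  have := Lj_le_size j (WF.leaf (⟨i.val, hi⟩ : Fin k) b)
  have e : eval (AT.leaf (⟨i.val, hi⟩ : Fin k) b) = val (rest k n) (.leaf i b) := by
    funext x; simp [val, eval, rest, hi]
  rw [e] at this
  simpa using this

theorem Sw_leaf {W : ℝ} (hW : 1 ≤ W) (j : ℕ) :
    Sw W (Lj j) (fun d : (Fin k → Bool) → Bool => (leafN (rest k n) d : ℝ)) ≤ 2 * k * W := by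
  classical
  have h := sum_leaf_nc (k := k) (n := n)
  have h' : ∑ d : (Fin k → Bool) → Bool, (if NC d then (leafN (rest k n) d : ℝ) else 0) ≤ 2 * k := by
    exact_mod_cast h
  refine le_trans ?_ (mul_le_mul_of_nonneg_right h' (by linarith))
  unfold Sw
  rw [Finset.sum_mul]
  refine Finset.sum_le_sum (fun d _ => ?_)
  split_ifs with hd
  · by_cases hl : leafN (rest k n) d = 0
    · simp [hl]
    · refine mul_le_mul_of_nonneg_left ?_ (by positivity)
      exact (pow_le_pow_right₀ hW (leaf_Lj j d hd hl)).trans (by simp)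
  · simp

theorem Sw_add {X : Type*} [DecidableEq X] [Fintype X] (W : ℝ) (e : (X → Bool) → ℕ) (F G : (X → Bool) → ℝ) :
    Sw W e (fun d => F d + G d) = Sw W e F + Sw W e G := by
  classical
  unfold Sw
  rw [← Finset.sum_add_distrib]
  refine Finset.sum_congr rfl (fun d _ => ?_)
  split_ifs <;> ring

theorem Sw_smul {X : Type*} [DecidableEq X] [Fintype X] (W r : ℝ) (e : (X → Bool) → ℕ) (F : (X → Bool) → ℝ) :
    Sw W e (fun d => r * F d) = r * Sw W e F := by
  classical
  unfold Sw
  rw [Finset.mul_sum]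
  refine Finset.sum_congr rfl (fun d _ => ?_)
  split_ifs <;> ring

theorem Sw_succ {W : ℝ} (hW : 1 ≤ W) {X : Type*} [DecidableEq X] [Fintype X] [Nonempty X] {e e' : (X → Bool) → ℕ} {F : (X → Bool) → ℝ}
    (hF : ∀ d, 0 ≤ F d) (he : ∀ d, e' d ≤ 1 + e d) : Sw W e' F ≤ W * Sw W e F := by
  refine (Sw_mono hW hF he (fun _ _ => le_rfl)).trans (le_of_eq ?_)
  classical
  unfold Sw
  rw [Finset.mul_sum]
  refine Finset.sum_congr rfl (fun d _ => ?_)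
  split_ifs
  · rw [pow_add]; ring
  · simp

theorem upper_bound (hk : 128 * (k + 1) ≤ n) (p : Bool → ((Fin k → Bool) → Bool) → ℝ)
    (hp0 : ∀ c d, 0 ≤ p c d) (hp1 : ∀ c, ∑ d, p c d = 1)
    (hp : ∀ c d, p c d = rho n * conv c (Qp (rest k n) c) (p (!c)) d)
    (f : (Fin k → Bool) → Bool) (hf : 3 ≤ Lcomp k f) (c : Bool) :
    p c f ≤ (32 * (k + 1) * rho n) ^ Lcomp k f := by
  classical
  have hn : 128 ≤ n := by omega
  have hn3 : 3 ≤ n := by omega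
  have hr := rho_pos hn3
  have hrle := rho_le hn3
  have hkR : (128:ℝ) * (k + 1) ≤ n := by exact_mod_cast hk
  have hk0 : (0:ℝ) ≤ k := by positivity
  have h16 : 16 ≤ sq n := by apply Real.le_sqrt_of_sq_le; linarith
  set ι := rest k n with hι
  set K : ℝ := 32 * (k + 1) with hK
  have hK0 : 0 < K := by positivity
  have hnr : (n:ℝ) * rho n ≤ 1 / 2 := by
    have := mul_le_mul_of_nonneg_left hrle (show (0:ℝ) ≤ n by positivity)
    have h5 : (n:ℝ) * (1 / (2 * n)) = 1 / 2 := by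
      have : (n:ℝ) ≠ 0 := by positivity
      field_simp
    linarith
  have hkr : (k + 1) * rho n ≤ 1 / 256 := by nlinarith
  set W : ℝ := 1 / (K * rho n) with hWdef
  have hWr : rho n * W = 1 / K := by
    rw [hWdef]; field_simp
  have hW : 1 ≤ W := by
    rw [hWdef, le_div_iff₀ (by positivity), hK]; linarith
  have hφ0 := fun c => phi_nonneg ι hn3 c
  have hE0 := fun c => Ee_nonneg ι hn3 c
  -- value at the unit
  have hE1 : ∀ c, Ee ι c (un c) ≤ 8 / 3 := by
    intro c
    have h1 := Ee_eq ι hn3 c (un c)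
    rw [conv_one, if_pos rfl] at h1
    have h2 := mul_le_mul_of_nonneg_right (phi_one_le ι hn c) (hE0 c (un c))
    linarith
  -- bound for `E`
  have hSE : ∀ j c, Sw W (Lj j) (phi ι c) ≤ 1 / 8 → Sw W (ej c j) (Ee ι c) ≤ 4 / 3 := by
    intro j c h
    have h1 : Sw W (ej c j) (phi ι c) ≤ 1 / 8 :=
      (Sw_mono hW (hφ0 c) (ej_le_Lj c j) (fun _ _ => le_rfl)).trans h
    have h2 : Sw W (ej c j) (Ee ι c) ≤ Sw W (ej c j) (conv c (phi ι c) (Ee ι c)) := by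
      refine Sw_mono hW (hE0 c) (fun _ => le_rfl) (fun d hd => ?_)
      rw [Ee_eq ι hn3 c d, if_neg ((NC_iff c d).1 hd).1, zero_add]
    have h3 := h2.trans (Sw_conv hW c (hφ0 c) (hE0 c) (ej_op c j))
    have e1 := mul_le_mul_of_nonneg_right (phi_one_le ι hn c) (Sw_nonneg hW (ej c j) (hE0 c))
    have e2 := mul_le_mul h1 (hE1 c) (hE0 c _) (by norm_num)
    have e3 := mul_le_mul_of_nonneg_right h1 (Sw_nonneg hW (ej c j) (hE0 c))
    linarith
  -- induction for `phi`
  have hΦ : ∀ j c, Sw W (Lj j) (phi ι c) ≤ 1 / 8 := by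
    intro j
    induction j with
    | zero =>
      intro c
      have h0 : ∀ d : (Fin k → Bool) → Bool, Lj 0 d = 0 := fun d => Nat.le_zero.1 (Lj_le 0 d)
      have e1 : Sw W (Lj 0) (phi ι c) = Sw 1 (Lj 0) (fun d => rho n * leafN ι d + Rm ι (!c) d) := by
        unfold Sw
        refine Finset.sum_congr rfl (fun d _ => ?_)
        rw [phi_eq' ι hn3, h0]; simp [mul_comm]
      rw [e1, Sw_add, Sw_smul]
      have h1 := mul_le_mul_of_nonneg_left (Sw_leaf (k := k) (n := n) le_rfl 0) hr.le
      have h2 : Sw 1 (Lj 0) (Rm ι (!c)) ≤ 1 / sq n := by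
        refine le_trans ?_ (sum_Rm ι hn3 (!c))
        unfold Sw
        refine Finset.sum_le_sum (fun d _ => ?_)
        have := Rm_nonneg ι hn3 (!c) d
        split_ifs
        · simp
        · exact this
      have h3 : (1:ℝ) / sq n ≤ 1 / 16 := one_div_le_one_div_of_le (by norm_num) h16
      nlinarith
    | succ j ih =>
      intro c
      have hS := hSE j (!c) (ih (!c))
      have h1 : Sw W (Lj (j+1)) (phi ι c) ≤ Sw W (Lj (j+1)) (fun d => rho n * leafN ι d + rho n * Ee ι (!c) d) := by
        refine Sw_mono hW (hφ0 c) (fun _ => le_rfl) (fun d hd => ?_)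
        rw [phi_eq' ι hn3, Rm, if_neg ((NC_iff (!c) d).1 hd).1]
        have := mul_nonneg hr.le (hφ0 (!c) d)
        linarith
      rw [Sw_add, Sw_smul, Sw_smul] at h1
      have h2 := mul_le_mul_of_nonneg_left (Sw_leaf (k := k) (n := n) hW (j+1)) hr.le
      have h3 := mul_le_mul_of_nonneg_left (Sw_succ hW (hE0 (!c)) (Lj_succ_le (!c) j)) hr.le
      have h4 : rho n * (2 * k * W) = 2 * k * (1 / K) := by rw [← hWr]; ring
      have h5 : rho n * (W * Sw W (ej (!c) j) (Ee ι (!c))) = (1 / K) * Sw W (ej (!c) j) (Ee ι (!c)) := by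
        rw [← hWr]; ring
      have h6 : (1 / K) * Sw W (ej (!c) j) (Ee ι (!c)) ≤ (1 / K) * (4 / 3) :=
        mul_le_mul_of_nonneg_left hS (by positivity)
      have h7 : 2 * k * (1 / K) + (1 / K) * (4 / 3) ≤ 1 / 8 := by
        rw [← sub_nonneg]
        have : 1 / 8 - (2 * k * (1 / K) + 1 / K * (4 / 3)) = (K / 8 - 2 * k - 4 / 3) / K := by
          field_simp
          ring
        rw [this]
        apply div_nonneg _ hK0.le
        rw [hK]; linarith
      linarith
  -- bounds for `Q`
  have hQ0 := fun c => Qp_nonneg ι hn3 c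
  have hSQ : ∀ j c, Sw W (ej c j) (Qp ι c) ≤ 80 / 9 := by
    intro j c
    have h1 : Sw W (ej c j) (Qp ι c) ≤ Sw W (ej c j) (conv c (Ee ι c) (Ee ι c)) := by
      refine Sw_mono hW (hQ0 c) (fun _ => le_rfl) (fun d hd => ?_)
      rw [Qp, Qq_eq ι hn3, if_neg ((NC_iff c d).1 hd).1, sub_zero]
    have h3 := h1.trans (Sw_conv hW c (hE0 c) (hE0 c) (ej_op c j))
    have hS := hSE j c (hΦ j c)
    have hS0 := Sw_nonneg hW (ej c j) (hE0 c)
    have e1 := mul_le_mul (hE1 c) hS hS0 (by norm_num)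
    have e2 := mul_le_mul hS hS hS0 (by norm_num)
    linarith
  have hQ1 : ∀ c, Qp ι c (un c) ≤ 64 / 9 := by
    intro c
    rw [Qp, Qq_eq ι hn3, conv_one, if_pos rfl]
    have e1 := mul_le_mul (hE1 c) (hE1 c) (hE0 c _) (by norm_num)
    linarith
  -- induction for `p`
  have hPi : ∀ j c, Sw W (Lj j) (p c) ≤ 1 := by
    intro j
    induction j with
    | zero =>
      intro c
      have h0 : ∀ d : (Fin k → Bool) → Bool, Lj 0 d = 0 := fun d => Nat.le_zero.1 (Lj_le 0 d)
      rw [← hp1 c]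
      unfold Sw
      refine Finset.sum_le_sum (fun d _ => ?_)
      split_ifs
      · simp [h0]
      · exact hp0 c d
    | succ j ih =>
      intro c
      have h1 : Sw W (Lj (j+1)) (p c) = rho n * Sw W (Lj (j+1)) (conv c (Qp ι c) (p (!c))) := by
        rw [← Sw_smul]; congr 1; funext d; exact hp c d
      have h2 := Sw_succ hW (conv_nonneg c (hQ0 c) (hp0 (!c))) (Lj_succ_le c j)
      have h3 := Sw_conv hW c (hQ0 c) (hp0 (!c)) (ej_op c j)
      have h4 : Sw W (ej c j) (p (!c)) ≤ 1 :=
        (Sw_mono hW (hp0 (!c)) (ej_le_Lj c j) (fun _ _ => le_rfl)).trans (ih (!c))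
      have h40 := Sw_nonneg hW (ej c j) (hp0 (!c))
      have h5 : p (!c) (un c) ≤ 1 := by
        rw [← hp1 (!c)]
        exact Finset.single_le_sum (fun d _ => hp0 (!c) d) (Finset.mem_univ _)
      have e1 := mul_le_mul (hQ1 c) h4 h40 (by norm_num)
      have e2 := mul_le_mul (hSQ j c) h5 (hp0 (!c) _) (by norm_num)
      have e3 := mul_le_mul (hSQ j c) h4 h40 (by norm_num)
      have h6 : Sw W (ej c j) (conv c (Qp ι c) (p (!c))) ≤ 26 := by linarith
      have h7 := mul_le_mul_of_nonneg_left (h2.trans (mul_le_mul_of_nonneg_left h6 (by linarith))) hr.le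
      rw [h1]
      refine h7.trans ?_
      rw [← mul_assoc, hWr, one_div_mul_eq_div, div_le_one hK0, hK]
      linarith
  have hfin := hPi (Lcomp k f) c
  have hnc : NC f := by
    unfold Lcomp at hf
    split_ifs at hf with h1 h2
    · omega
    · omega
    · push Not at h1
      exact h1
  have h1 : p c f * W ^ Lcomp k f ≤ 1 := by
    refine le_trans (le_of_eq_of_le ?_ (Finset.single_le_sum (f := fun d => if NC d then p c d * W ^ Lj (Lcomp k f) d else 0)
      (fun d _ => ?_) (Finset.mem_univ f))) hfin
    · simp only [hnc, if_true]; rw [Lj_Lcomp hf]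
    · have := hp0 c d
      split_ifs <;> positivity
  rw [hWdef, one_div, inv_pow, ← div_eq_mul_inv, div_le_one (by positivity)] at h1
  exact h1

end upper2
end TreeAux

set_option linter.unusedSectionVars false
namespace TreeAux
open Finset Filter Topology AT

section lower
variable {X : Type*} {n : ℕ} [DecidableEq X] [Fintype X] [Nonempty X] (ι : X → Fin n → Bool)

/-- literals in conflict with `d` -/
noncomputable def cf (c : Bool) (d : X → Bool) : Finset (Fin n × Bool) :=
  univ.filter (fun p : Fin n × Bool => op c d (val ι (.leaf p.1 p.2)) = un (!c))

/-- opposite literal -/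
def ng (p : Fin n × Bool) : Fin n × Bool := (p.1, !p.2)

theorem ng_ng (p : Fin n × Bool) : ng (ng p) = p := by simp [ng]

theorem op_ng (c : Bool) (p : Fin n × Bool) :
    op c (val ι (.leaf p.1 p.2)) (val ι (.leaf (ng p).1 (ng p).2)) = un (!c) := by
  funext x
  rcases p with ⟨i, b⟩
  cases c <;> cases b <;> simp [op, val, eval, ng, un]

theorem cf_mono (c : Bool) (d g : X → Bool) : cf ι c d ⊆ cf ι c (op c d g) := by
  intro p hp
  simp only [cf, mem_filter, mem_univ, true_and] at hp ⊢
  rw [op_comm c d g, op_assoc, hp, op_abs]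

theorem cf_succ (c : Bool) (d : X → Bool) (p : Fin n × Bool) (hp : ng p ∉ cf ι c d) :
    (cf ι c d).card + 1 ≤ (cf ι c (op c d (val ι (.leaf p.1 p.2)))).card := by
  rw [← Finset.card_insert_of_notMem hp]
  apply Finset.card_le_card
  intro q hq
  rcases Finset.mem_insert.1 hq with h | h
  · subst h
    simp only [cf, mem_filter, mem_univ, true_and]
    rw [op_assoc, op_ng, op_abs]
  · exact cf_mono ι c d _ h

/-- mass of lists not absorbing `d` -/
noncomputable def Zz (c : Bool) (d : X → Bool) : ℝ := ∑ v, if op c d v = un (!c) then 0 else Ee ι c v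

theorem conv_weight (c : Bool) (F G w : (X → Bool) → ℝ) :
    ∑ d, conv c F G d * w d = ∑ g, F g * ∑ h, G h * w (op c g h) := by
  unfold conv
  simp only [Finset.sum_mul]
  rw [Finset.sum_comm]
  refine Finset.sum_congr rfl (fun g _ => ?_)
  rw [Finset.sum_comm, Finset.mul_sum]
  refine Finset.sum_congr rfl (fun h _ => ?_)
  simp only [ite_mul, zero_mul, Finset.sum_ite_eq, Finset.mem_univ, if_true]
  ring

theorem Zz_eq (hn : 3 ≤ n) (c : Bool) (d : X → Bool) :
    Zz ι c d = (if d = un (!c) then 0 else 1) + ∑ g, phi ι c g * Zz ι c (op c d g) := by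
  have h1 : ∀ d : X → Bool, Zz ι c d = ∑ v, Ee ι c v * (if op c d v = un (!c) then 0 else 1) := by
    intro d; unfold Zz
    refine Finset.sum_congr rfl (fun v _ => ?_)
    split_ifs <;> simp
  simp only [h1]
  have h2 : ∀ v, Ee ι c v * (if op c d v = un (!c) then (0:ℝ) else 1) =
      (if v = un c then (if d = un (!c) then 0 else 1) else 0) +
      conv c (phi ι c) (Ee ι c) v * (if op c d v = un (!c) then 0 else 1) := by
    intro v
    rw [Ee_eq ι hn, add_mul]
    congr 1
    by_cases h : v = un c
    · subst h; simp
    · simp [h]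
  rw [Finset.sum_congr rfl (fun v _ => h2 v), Finset.sum_add_distrib, conv_weight]
  simp [op_assoc]

theorem sum_leaf (c : Bool) (w : (X → Bool) → ℝ) :
    ∑ g, (leafN ι g : ℝ) * w g = ∑ p : Fin n × Bool, w (val ι (.leaf p.1 p.2)) := by
  have h1 : ∀ g, (leafN ι g : ℝ) * w g = ∑ p : Fin n × Bool, if val ι (.leaf p.1 p.2) = g then w g else 0 := by
    intro g
    unfold leafN
    rw [Finset.card_filter]
    push_cast
    rw [Finset.sum_mul]
    refine Finset.sum_congr rfl (fun p _ => ?_)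
    split_ifs <;> simp
  rw [Finset.sum_congr rfl (fun g _ => h1 g), Finset.sum_comm]
  simp

theorem sum_Rm' (hn : 3 ≤ n) (c : Bool) : ∑ d, Rm ι (!c) d = sq n / (sq n + 1) - 2 * n * rho n := by
  have h := (sum_phi_Ee ι hn c).1
  rw [Finset.sum_congr rfl (fun d _ => phi_eq' ι hn c d), Finset.sum_add_distrib] at h
  have h2 := sum_leaf ι c (fun _ => rho n)
  rw [h2] at h
  simp at h
  linarith

theorem absorb_lower (hn : 128 ≤ n) (c : Bool) : (sq n + 1) / 128 ≤ Ee ι c (un (!c)) := by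
  have hn3 : 3 ≤ n := by omega
  have hr := rho_pos hn3
  have hnR : (128:ℝ) ≤ n := by exact_mod_cast hn
  have h16 : 16 ≤ sq n := by apply Real.le_sqrt_of_sq_le; linarith
  have hs2 := sq_sq n
  obtain ⟨s, hs⟩ : ∃ s, s = sq n := ⟨_, rfl⟩
  obtain ⟨r, hrdef⟩ : ∃ r : ℕ, r = ⌊s / 8⌋₊ := ⟨_, rfl⟩
  have hr1 : (r:ℝ) ≤ s / 8 := by rw [hrdef]; apply Nat.floor_le; rw [hs]; linarith
  have hr2 : s / 8 < r + 1 := by rw [hrdef]; apply Nat.lt_floor_add_one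
  rw [← hs] at h16 hs2
  have hrho : rho n * (s * (s + 2)) = 1 := by
    unfold rho; rw [← hs]; field_simp
  obtain ⟨β, hβ⟩ : ∃ β, β = (2 * n - 2 * r) * rho n := ⟨_, rfl⟩
  have hβ0 : 0 ≤ β := by
    rw [hβ]; apply mul_nonneg _ hr.le; nlinarith
  have hβ1 : β ≤ 1 := by
    rw [hβ, ← hs2, ← hrho, mul_comm]
    apply mul_le_mul_of_nonneg_left _ hr.le
    have : (0:ℝ) ≤ r := by positivity
    nlinarith
  have hβ2 : 1 - 9 / 4 / (s + 2) ≤ β := by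
    have h1 : 1 - 9 / 4 / (s + 2) = (s^2 - s / 4) * rho n := by
      unfold rho; rw [← hs]; field_simp; ring
    rw [h1, hβ, ← hs2]
    apply mul_le_mul_of_nonneg_right _ hr.le
    linarith
  have hβr : 1 / 2 ≤ β ^ r := by
    have h0 : (9:ℝ) / 4 / (s + 2) ≤ 1 := by rw [div_le_one (by linarith)]; linarith
    have h1 := one_add_mul_le_pow (a := -(9 / 4 / (s + 2))) (by linarith) r
    have h2 : (1 + -(9 / 4 / (s + 2))) ^ r ≤ β ^ r := by
      apply pow_le_pow_left₀ (by linarith)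
      linarith
    have h3 : (r:ℝ) * (9 / 4 / (s + 2)) ≤ 1 / 2 := by
      rw [mul_div_assoc', div_le_iff₀ (by linarith)]
      linarith
    linarith
  obtain ⟨κ, hκ⟩ : ∃ κ : ℕ → ℝ, κ = fun a => β ^ (r - a) / 64 := ⟨_, rfl⟩
  have hκ0 : ∀ a, 0 ≤ κ a := by intro a; rw [hκ]; positivity
  have hκ1 : ∀ a, κ a ≤ 1 := by
    intro a; rw [hκ]; have := pow_le_one₀ (n := r - a) hβ0 hβ1
    show β ^ (r - a) / 64 ≤ 1
    linarith
  have hκm : ∀ a b, a ≤ b → κ a ≤ κ b := by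
    intro a b hab
    rw [hκ]
    show β ^ (r - a) / 64 ≤ β ^ (r - b) / 64
    have := pow_le_pow_of_le_one hβ0 hβ1 (show r - b ≤ r - a by omega)
    linarith
  obtain ⟨V, hV⟩ : ∃ V : (X → Bool) → ℝ, V = fun d => if d = un (!c) then 0 else (s + 1) * (1 - κ (cf ι c d).card) := ⟨_, rfl⟩
  have hVle : ∀ d a, a ≤ (cf ι c d).card → V d ≤ (s + 1) * (1 - κ a) := by
    intro d a ha
    rw [hV]
    show (if d = un (!c) then 0 else (s + 1) * (1 - κ (cf ι c d).card)) ≤ _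
    split_ifs
    · apply mul_nonneg (by linarith); have := hκ1 a; linarith
    · apply mul_le_mul_of_nonneg_left _ (by linarith)
      have := hκm _ _ ha; linarith
  have hsuper : ∀ d, d ≠ un (!c) → 1 + ∑ g, phi ι c g * V (op c d g) ≤ V d := by
    intro d hd
    obtain ⟨a, ha⟩ : ∃ a, a = (cf ι c d).card := ⟨_, rfl⟩
    have e1 : ∑ g, phi ι c g * V (op c d g) =
        rho n * (∑ p : Fin n × Bool, V (op c d (val ι (.leaf p.1 p.2)))) + ∑ g, Rm ι (!c) g * V (op c d g) := by
      rw [← sum_leaf ι c (fun g => V (op c d g)), Finset.mul_sum, ← Finset.sum_add_distrib]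
      refine Finset.sum_congr rfl (fun g _ => ?_)
      rw [phi_eq' ι hn3]; ring
    have e2 : ∑ g, Rm ι (!c) g * V (op c d g) ≤ (s / (s + 1) - 2 * n * rho n) * ((s + 1) * (1 - κ a)) := by
      rw [hs, ← sum_Rm' ι hn3 c, ← hs, Finset.sum_mul]
      refine Finset.sum_le_sum (fun g _ => mul_le_mul_of_nonneg_left ?_ (Rm_nonneg ι hn3 _ g))
      apply hVle
      rw [ha]
      exact Finset.card_le_card (cf_mono ι c d g)
    have eV : V d = (s + 1) * (1 - κ a) := by rw [hV, ha]; simp [hd]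
    have hcard : (Fintype.card (Fin n × Bool) : ℝ) = 2 * n := by simp; ring
    have hsB : s / (s + 1) = 1 - 1 / (s + 1) := by field_simp; ring
    have hδ : 1 / (s + 1) * (s + 1) = 1 := by field_simp
    have hleafV : ∀ (p : Fin n × Bool), V (op c d (val ι (.leaf p.1 p.2))) ≤ (s + 1) * (1 - κ a) - (if p ∈ cf ι c d then (s + 1) * (1 - κ a) else 0) := by
      intro p
      split_ifs with h
      · simp only [cf, mem_filter, mem_univ, true_and] at h
        rw [h, hV]; simp
      · rw [sub_zero]
        apply hVle
        rw [ha]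
        exact Finset.card_le_card (cf_mono ι c d _)
    rw [e1, eV]
    by_cases har : r ≤ a
    · have hk : κ a = 1 / 64 := by rw [hκ]; simp [Nat.sub_eq_zero_of_le har]
      have e3 : ∑ p : Fin n × Bool, V (op c d (val ι (.leaf p.1 p.2))) ≤ (2 * n - a) * ((s + 1) * (1 - κ a)) := by
        refine (Finset.sum_le_sum (fun p _ => hleafV p)).trans (le_of_eq ?_)
        rw [Finset.sum_sub_distrib, Finset.sum_const, Finset.card_univ, nsmul_eq_mul, hcard, ← Finset.sum_filter]
        simp [ha]
        ring
      have e4 := mul_le_mul_of_nonneg_left e3 hr.le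
      have hra : (r:ℝ) ≤ a := by exact_mod_cast har
      have e5 : 1 ≤ 63 * (a * rho n) * (s + 1) := by
        have : s * (s + 2) ≤ 63 * a * (s + 1) := by nlinarith
        have h := mul_le_mul_of_nonneg_left this hr.le
        rw [hrho] at h
        linarith
      rw [hsB] at e2
      rw [hk] at e2 e4 ⊢
      clear hsB
      generalize 1 / (s + 1) = Δ at e2 hδ
      linarith
    · push Not at har
      have hk : κ a = β * κ (a + 1) := by
        rw [hκ]
        show β ^ (r - a) / 64 = β * (β ^ (r - (a + 1)) / 64)
        rw [show r - a = (r - (a + 1)) + 1 by omega, pow_succ]; ring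
      have hle : ∀ (p : Fin n × Bool), V (op c d (val ι (.leaf p.1 p.2))) ≤ (s + 1) * (1 - κ (a + 1)) +
          ((if p ∈ cf ι c d then 0 else 0) + (if ng p ∈ cf ι c d then (s + 1) * κ (a + 1) else 0)) := by
        intro p
        by_cases h : ng p ∈ cf ι c d
        · simp only [h, if_true, ite_self, zero_add]
          refine (hVle _ 0 (Nat.zero_le _)).trans ?_
          have := mul_nonneg (show 0 ≤ s + 1 by linarith) (hκ0 0)
          linarith
        · simp only [h, if_false, ite_self, add_zero]
          apply hVle
          rw [ha]
          exact cf_succ ι c d p h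
      have hcn : ∑ p : Fin n × Bool, (if ng p ∈ cf ι c d then (s + 1) * κ (a + 1) else 0) = a * ((s + 1) * κ (a + 1)) := by
        have hsw := Fintype.sum_equiv (⟨ng, ng, ng_ng, ng_ng⟩ : Fin n × Bool ≃ Fin n × Bool)
          (fun p => if ng p ∈ cf ι c d then (s + 1) * κ (a + 1) else 0)
          (fun p => if p ∈ cf ι c d then (s + 1) * κ (a + 1) else 0) (fun p => rfl)
        rw [hsw]
        rw [← Finset.sum_filter]
        simp [ha]
      have e3 : ∑ p : Fin n × Bool, V (op c d (val ι (.leaf p.1 p.2))) ≤ 2 * n * ((s + 1) * (1 - κ (a + 1))) + a * ((s + 1) * κ (a + 1)) := by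
        refine (Finset.sum_le_sum (fun p _ => hle p)).trans (le_of_eq ?_)
        rw [Finset.sum_add_distrib, Finset.sum_add_distrib, hcn, Finset.sum_const, Finset.card_univ, nsmul_eq_mul, hcard]
        simp
      have e4 := mul_le_mul_of_nonneg_left e3 hr.le
      have hra : (a:ℝ) ≤ r := by exact_mod_cast har.le
      have e6 : (s / (s + 1) - 2 * n * rho n) * ((s + 1) * (1 - κ a)) ≤ (s / (s + 1) - 2 * n * rho n) * (s + 1) := by
        have h0 : 0 ≤ s / (s + 1) - 2 * n * rho n := by
          rw [hs, ← sum_Rm' ι hn3 c]; exact Finset.sum_nonneg (fun g _ => Rm_nonneg ι hn3 _ g)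
        have := mul_nonneg h0 (mul_nonneg (show 0 ≤ s + 1 by linarith) (hκ0 a))
        nlinarith
      have e7 : κ a * (s + 1) ≤ (2 * n - 2 * a) * rho n * κ (a + 1) * (s + 1) := by
        rw [hk, hβ]
        apply mul_le_mul_of_nonneg_right _ (by linarith)
        apply mul_le_mul_of_nonneg_right _ (hκ0 _)
        apply mul_le_mul_of_nonneg_right _ hr.le
        linarith
      have e8 : 0 ≤ a * rho n * κ (a + 1) * (s + 1) := by
        have := hκ0 (a + 1)
        positivity
      rw [hsB] at e2 e6
      clear hsB
      generalize 1 / (s + 1) = Δ at e2 e6 hδ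
      linarith
  -- maximum principle
  have hmax : ∀ d, Zz ι c d ≤ V d := by
    obtain ⟨d0, hd0⟩ := Finite.exists_max (fun d => Zz ι c d - V d)
    have hle0 : Zz ι c d0 - V d0 ≤ 0 := by
      by_contra hpos
      push Not at hpos
      have hne : d0 ≠ un (!c) := by
        intro h
        rw [h] at hpos
        have h1 : Zz ι c (un (!c)) = 0 := by simp [Zz]
        have h2 : V (un (!c)) = 0 := by rw [hV]; simp
        linarith
      have h1 := Zz_eq ι hn3 c d0
      rw [if_neg hne] at h1
      have h2 := hsuper d0 hne
      have h3 : ∑ g, phi ι c g * (Zz ι c (op c d0 g) - V (op c d0 g)) ≤ s / (s + 1) * (Zz ι c d0 - V d0) := by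
        rw [hs, ← (sum_phi_Ee ι hn3 c).1, Finset.sum_mul]
        exact Finset.sum_le_sum (fun g _ => mul_le_mul_of_nonneg_left (hd0 _) (phi_nonneg ι hn3 c g))
      simp only [mul_sub, Finset.sum_sub_distrib] at h3
      have h4 : s / (s + 1) < 1 := by rw [div_lt_one (by linarith)]; linarith
      nlinarith
    intro d
    have := hd0 d
    linarith
  have hZ : Zz ι c (un c) = (s + 1) - Ee ι c (un (!c)) := by
    have h := (sum_phi_Ee ι hn3 c).2
    rw [hs, ← h]
    rw [eq_sub_iff_add_eq]
    unfold Zz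
    simp only [un_op]
    have : Ee ι c (un (!c)) = ∑ v, if v = un (!c) then Ee ι c v else 0 := by simp
    rw [this, ← Finset.sum_add_distrib]
    refine Finset.sum_congr rfl (fun v _ => ?_)
    split_ifs <;> simp
  have h1 := (hmax (un c)).trans (hVle _ 0 (Nat.zero_le _))
  rw [hZ] at h1
  have h2 : 1 / 128 ≤ κ 0 := by
    rw [hκ]
    show 1 / 128 ≤ β ^ (r - 0) / 64
    rw [Nat.sub_zero]; linarith
  rw [← hs]
  nlinarith

theorem const_lower (hn : 128 ≤ n) (p : Bool → (X → Bool) → ℝ) (hp0 : ∀ c d, 0 ≤ p c d)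
    (hp1 : ∀ c, ∑ d, p c d = 1) (hp : ∀ c d, p c d = rho n * conv c (Qp ι c) (p (!c)) d) (c : Bool) :
    1 / 128 ≤ p c (un (!c)) := by
  have hn3 : 3 ≤ n := by omega
  have hr := rho_pos hn3
  have hs := sq_gt hn3
  have h1 := absorb_lower ι hn c
  have h2 := conv_abs_ge c (Ee_nonneg ι hn3 c) (Ee_nonneg ι hn3 c)
  rw [← Qq_eq ι hn3, (sum_phi_Ee ι hn3 c).2] at h2
  have h3 := conv_abs_ge c (Qp_nonneg ι hn3 c) (hp0 (!c))
  rw [hp1] at h3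
  have h4 : Qp ι c (un (!c)) = Qq ι c (un (!c)) := by
    rw [Qp, if_neg, sub_zero]
    intro h
    have := congrFun h (Classical.arbitrary X)
    simp [un] at this
  rw [hp c]
  rw [h4] at h3
  have h5 := rho_crit hn3
  have h6 : (sq n + 1) / 128 * (sq n + 1) ≤ conv c (Qp ι c) (p (!c)) (un (!c)) := by
    have := mul_le_mul_of_nonneg_right h1 (show 0 ≤ sq n + 1 by linarith)
    linarith
  have h7 := mul_le_mul_of_nonneg_left h6 hr.le
  nlinarith

end lower
end TreeAux

set_option linter.unusedSectionVars false
namespace TreeAux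
open Finset Filter Topology AT

section final
variable {k n : ℕ}

mutual
/-- renaming of variables -/
def ren (h : k ≤ n) : AT k → AT n
  | .leaf i b => .leaf (Fin.castLE h i) b
  | .node c ts => .node c (renL h ts)
/-- renaming of variables in a list -/
def renL (h : k ≤ n) : List (AT k) → List (AT n)
  | [] => []
  | t :: ts => ren h t :: renL h ts
end

theorem renL_map (h : k ≤ n) (l : List (AT k)) : renL h l = l.map (ren h) := by
  induction l with
  | nil => simp [renL]
  | cons t l ih => simp [renL, ih]

mutual
theorem size_ren (h : k ≤ n) : ∀ t : AT k, size (ren h t) = size t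
  | .leaf i b => by simp [ren, size]
  | .node c ts => by simp [ren, size_renL h ts]
theorem size_renL (h : k ≤ n) : ∀ l : List (AT k), sizeList (renL h l) = sizeList l
  | [] => by simp [renL]
  | t :: ts => by simp [renL, size_ren h t, size_renL h ts]
end

mutual
theorem eval_ren (h : k ≤ n) (x : Fin n → Bool) : ∀ t : AT k, eval (ren h t) x = eval t (fun j => x (Fin.castLE h j))
  | .leaf i b => by simp [ren, eval]
  | .node c ts => by simp [ren, eval, eval_renL h x ts]
theorem eval_renL (h : k ≤ n) (x : Fin n → Bool) : ∀ (l : List (AT k)) (c : Bool),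
    evalList c (renL h l) x = evalList c l (fun j => x (Fin.castLE h j))
  | [], c => by simp [renL, evalList]
  | t :: ts, c => by simp [renL, evalList, eval_ren h x t, eval_renL h x ts]
end

theorem rootConn_ren (h : k ≤ n) (t : AT k) : rootConn (ren h t) = rootConn t := by
  cases t <;> simp [ren, rootConn]

theorem WF_ren (h : k ≤ n) {t : AT k} (ht : WF t) : WF (ren h t) := by
  induction ht with
  | leaf i b => rw [ren]; exact WF.leaf _ _
  | node c ts h2 hw hr ih =>
    rw [ren, renL_map]
    refine WF.node _ _ (by simpa using h2) ?_ ?_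
    · intro t ht
      obtain ⟨t', ht', rfl⟩ := List.mem_map.1 ht
      exact ih t' ht'
    · intro t ht
      obtain ⟨t', ht', rfl⟩ := List.mem_map.1 ht
      rw [rootConn_ren]; exact hr t' ht'

/-- minimal trees exist -/
theorem exists_min (f : (Fin k → Bool) → Bool) (hf : 3 ≤ Lcomp k f) :
    ∃ t : AT k, WF t ∧ size t = Lcomp k f ∧ eval t = f := by
  classical
  have h1 : Lcomp k f = sInf {m | ∃ t : AT k, WF t ∧ size t = m ∧ eval t = f} := by
    unfold Lcomp at hf ⊢
    split_ifs at hf ⊢ with h1 h2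
    · omega
    · omega
    · rfl
  have hne : {m | ∃ t : AT k, WF t ∧ size t = m ∧ eval t = f}.Nonempty := by
    by_contra h
    rw [Set.not_nonempty_iff_eq_empty] at h
    rw [h1, h, Nat.sInf_empty] at hf
    omega
  have := Nat.sInf_mem hne
  rw [← h1] at this
  exact this

theorem exists_min_node (f : (Fin k → Bool) → Bool) (hf : 3 ≤ Lcomp k f) :
    ∃ (c : Bool) (ts : List (AT k)), 2 ≤ ts.length ∧ AdmL c ts ∧ 1 + sizeList ts = Lcomp k f ∧
      ∀ x, evalList c ts x = f x := by
  obtain ⟨t, hw, hs, he⟩ := exists_min f hf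
  cases hw with
  | leaf i b => simp at hs; omega
  | node c ts h2 hw hr =>
    refine ⟨c, ts, h2, fun t ht => ⟨hw t ht, hr t ht⟩, by simpa using hs, fun x => ?_⟩
    rw [← he, eval]

theorem rN_expand (h : k ≤ n) (f : (Fin k → Bool) → Bool) (c : Bool) (ts : List (AT k)) (h2 : 2 ≤ ts.length)
    (ha : AdmL c ts) (he : ∀ x, evalList c ts x = f x) (m : ℕ) :
    rN (X := Fin n → Bool) id (!c) m (un c) ≤ rN (X := Fin n → Bool) id c (m + (1 + sizeList ts)) (extend h f) := by
  unfold rN cnt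
  refine Set.ncard_le_ncard_of_injOn (fun T => .node c (renL h ts ++ [T])) ?_ ?_ ((finP_tree _).fin _ _ _)
  · rintro T ⟨hT, hs, hv⟩
    refine ⟨?_, ?_, ?_⟩
    · rw [Rtd_iff]
      refine ⟨_, rfl, ?_, ?_⟩
      · rw [renL_map]; simp; omega
      · intro t ht
        rcases List.mem_append.1 ht with ht | ht
        · rw [renL_map] at ht
          obtain ⟨t', ht', rfl⟩ := List.mem_map.1 ht
          exact ⟨WF_ren h (ha t' ht').1, by rw [rootConn_ren]; exact (ha t' ht').2⟩
        · simp at ht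
          subst ht
          refine ⟨hT.1, ?_⟩
          rw [hT.2]
          cases c <;> simp
    · simp [sizeList_append, size_renL, hs]; omega
    · rw [val_node, valL_append, valL_cons, valL_nil, op_un, hv, op_un]
      funext x
      simp [valL, eval_renL, he, extend]
  · intro T _ T' _ e
    simpa using e

theorem rN_restrict (h : k ≤ n) (f : (Fin k → Bool) → Bool) (c : Bool) (m : ℕ) :
    rN (X := Fin n → Bool) id c m (extend h f) ≤ rN (rest k n) c m f := by
  unfold rN cnt
  refine Set.ncard_le_ncard ?_ ((finP_tree _).fin _ _ _)
  rintro T ⟨hT, hs, hv⟩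
  refine ⟨hT, hs, ?_⟩
  funext x
  have := congrFun hv (rest k n x)
  simp only [val, id, extend] at this
  rw [val, this]
  congr 1
  funext j
  simp [rest]

theorem countIn_eq (S : Set (AT n)) (m : ℕ) (hm : 2 ≤ m) : countIn n S m =
    Set.ncard {t : AT n | Rtd true t ∧ size t = m ∧ t ∈ S} + Set.ncard {t : AT n | Rtd false t ∧ size t = m ∧ t ∈ S} := by
  have hfin : ∀ c, {t : AT n | Rtd c t ∧ size t = m ∧ t ∈ S}.Finite := fun c =>
    (finP_tree (Rtd c) m).subset (fun t ht => ⟨ht.1, ht.2.1⟩)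
  rw [← Set.ncard_union_eq ?_ (hfin true) (hfin false)]
  · unfold countIn
    rw [← Nat.card_coe_set_eq]
    refine Nat.card_congr (Equiv.subtypeEquivRight (fun t => ?_))
    constructor
    · rintro ⟨h1, h2, h3⟩
      cases h2 with
      | leaf i b => simp at h3; omega
      | node c ts a1 a2 a3 =>
        cases c
        · exact Or.inr ⟨⟨WF.node _ _ a1 a2 a3, rfl⟩, h3, h1⟩
        · exact Or.inl ⟨⟨WF.node _ _ a1 a2 a3, rfl⟩, h3, h1⟩
    · rintro (h | h)
      · exact ⟨h.2.2, h.1.1, h.2.1⟩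
      · exact ⟨h.2.2, h.1.1, h.2.1⟩
  · rw [Set.disjoint_left]
    intro t h1 h2
    have := h1.1.2.symm.trans h2.1.2
    simp at this

theorem Pmn_eq (g : (Fin n → Bool) → Bool) (m : ℕ) (hm : 2 ≤ m) : Pmn n m g =
    ((rN (X := Fin n → Bool) id true m g : ℝ) / bT n true m + (rN (X := Fin n → Bool) id false m g : ℝ) / bT n true m) / 2 := by
  have h1 : A n m = bT n true m + bT n true m := by
    unfold A
    rw [countIn_eq _ _ hm]
    nth_rewrite 1 [← rT_eq n true m hm]
    rw [← rT_eq n false m hm]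
    simp [rT]
  have h2 : countIn n {t | eval t = g} m = rN (X := Fin n → Bool) id true m g + rN (X := Fin n → Bool) id false m g := by
    rw [countIn_eq _ _ hm]
    rfl
  unfold Pmn
  rw [h1, h2]
  push_cast
  rw [← add_div, div_div]
  congr 1
  ring

theorem rho_ge (hn : 3 ≤ n) : 1 / (4 * n) ≤ rho n := by
  have hs := sq_gt hn
  have hs2 := sq_sq n
  unfold rho
  apply one_div_le_one_div_of_le (by positivity)
  nlinarith

theorem final_bounds (h : k ≤ n) (hkn : 128 * (k + 1) ≤ n) (f : (Fin k → Bool) → Bool) (hf : 3 ≤ Lcomp k f) :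
    ∃ p : ℝ, Tendsto (fun m => Pmn n m (extend h f)) atTop (𝓝 p) ∧
      ((1 / 4) ^ Lcomp k f / 256) / (n : ℝ) ^ (Lcomp k f) ≤ p ∧
      p ≤ (16 * (k + 1)) ^ Lcomp k f / (n : ℝ) ^ (Lcomp k f) := by
  have hn3 : 3 ≤ n := by omega
  have hn : 128 ≤ n := by omega
  have hr := rho_pos hn3
  obtain ⟨p, hp, hp0, hp1, hpe⟩ := limit_exists (X := Fin n → Bool) id hn3
  obtain ⟨q, hq, hq0, hq1, hqe⟩ := limit_exists (rest k n) hn3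
  obtain ⟨hbpos, -⟩ := b_ratio hn3
  refine ⟨(p true (extend h f) + p false (extend h f)) / 2, ?_, ?_, ?_⟩
  · refine (((hp true (extend h f)).add (hp false (extend h f))).div_const 2).congr' ?_
    filter_upwards [eventually_ge_atTop 2] with m hm
    exact (Pmn_eq _ m hm).symm
  · obtain ⟨c, ts, h2, ha, hs, he⟩ := exists_min_node f hf
    have h1 : p (!c) (un c) * rho n ^ Lcomp k f ≤ p c (extend h f) := by
      have t1 := (hp (!c) (un c)).mul (b_shift hn3 (Lcomp k f))
      have t2 := (hp c (extend h f)).comp (tendsto_add_atTop_nat (Lcomp k f))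
      refine le_of_tendsto_of_tendsto t1 t2 ?_
      filter_upwards [hbpos] with m hm
      simp only [Function.comp]
      rw [div_mul_div_cancel₀ hm.ne']
      apply div_le_div_of_nonneg_right _ (by positivity)
      have := rN_expand h f c ts h2 ha he m
      rw [hs] at this
      exact_mod_cast this
    have h3 := const_lower (X := Fin n → Bool) id hn p hp0 hp1 hpe (!c)
    rw [Bool.not_not] at h3
    have h4 : (1 / (4 * n : ℝ)) ^ Lcomp k f ≤ rho n ^ Lcomp k f :=
      pow_le_pow_left₀ (by positivity) (rho_ge hn3) _
    have h5 : (1 / 128) * (1 / (4 * n : ℝ)) ^ Lcomp k f ≤ p c (extend h f) :=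
      (mul_le_mul h3 h4 (by positivity) (hp0 _ _)).trans h1
    have h6 : ((1 / 4) ^ Lcomp k f / 256) / (n : ℝ) ^ (Lcomp k f) = (1 / 128) * (1 / (4 * n : ℝ)) ^ Lcomp k f / 2 := by
      rw [show (1 / (4 * n : ℝ)) = (1 / 4) / n by field_simp, div_pow _ (n:ℝ)]
      generalize ((1:ℝ) / 4) ^ Lcomp k f = u
      ring
    rw [h6]
    have := hp0 true (extend h f)
    have := hp0 false (extend h f)
    cases c <;> linarith
  · have h1 : ∀ c, p c (extend h f) ≤ (16 * (k + 1)) ^ Lcomp k f / (n : ℝ) ^ (Lcomp k f) := by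
      intro c
      have e1 : p c (extend h f) ≤ q c f := by
        refine le_of_tendsto_of_tendsto' (hp c (extend h f)) (hq c f) (fun m => ?_)
        apply div_le_div_of_nonneg_right _ (by positivity)
        exact_mod_cast rN_restrict h f c m
      refine e1.trans ((upper_bound hkn q hq0 hq1 hqe f hf c).trans ?_)
      rw [← div_pow]
      apply pow_le_pow_left₀ (by positivity)
      have := mul_le_mul_of_nonneg_left (rho_le hn3) (show (0:ℝ) ≤ 32 * (k + 1) by positivity)
      refine this.trans (le_of_eq ?_)
      have : (n:ℝ) ≠ 0 := by
        have : 0 < n := by omega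
        positivity
      field_simp
      norm_num
    have := h1 true
    have := h1 false
    linarith

end final
end TreeAux

/-- For a fixed Boolean function `f` of `n₀` variables with tree size complexity
`L(f) ≥ 3`, identified with its extension to `n ≥ n₀` variables,
`P_n(f) = Θ(n^{-L(f)})` as `n → ∞`. -/
theorem statement3 (n₀ : ℕ) (hn₀ : 1 ≤ n₀) (f : (Fin n₀ → Bool) → Bool)
    (hf : 3 ≤ Lcomp n₀ f) :
    ∃ c₁ c₂ : ℝ, 0 < c₁ ∧ c₁ ≤ c₂ ∧ ∃ N : ℕ,
      ∀ n : ℕ, N ≤ n → ∀ h : n₀ ≤ n,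
        ∃ p : ℝ,
          Filter.Tendsto (fun m => Pmn n m (extend h f)) Filter.atTop (nhds p) ∧
          c₁ / (n : ℝ) ^ (Lcomp n₀ f) ≤ p ∧ p ≤ c₂ / (n : ℝ) ^ (Lcomp n₀ f) := by
  refine ⟨(1 / 4) ^ Lcomp n₀ f / 256, (16 * (n₀ + 1)) ^ Lcomp n₀ f, by positivity, ?_, 128 * (n₀ + 1),
    fun n hn h => TreeAux.final_bounds h hn f hf⟩
  have h1 : ((1:ℝ) / 4) ^ Lcomp n₀ f ≤ 1 := pow_le_one₀ (by norm_num) (by norm_num)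
  have h2 : (1:ℝ) ≤ (16 * (n₀ + 1)) ^ Lcomp n₀ f := by
    apply one_le_pow₀
    have : (0:ℝ) ≤ n₀ := by positivity
    linarith
  linarith
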